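/- arXiv:2308.09491 — 2 statements merged into one kernel-verified Lean document; each statement's English description precedes it below -/
import Mathlib

section
/- Let G be a matching covered graph, C a tight cut of G, and G_1, G_2 the two C-contractions of G. Then both G_1 and G_2 are matching covered, and b(G) = b(G_1) + b(G_2), where b denotes the number of bricks in any tight cut decomposition. -/
open Classical in
/-- A finite multigraph: loops are forbidden, multiple edges are allowed. -/
structure Multigraph where
  V : Type
  E : Type
  [fintV : Fintype V]
  [fintE : Fintype E]
  ends : E → Sym2 V
  no_loops : ∀ e, ¬ (ends e).IsDiag

attribute [instance] Multigraph.fintV Multigraph.fintE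

namespace Multigraph

variable (G : Multigraph)

/-- Vertex `v` is incident with edge `e`. -/
def Inc (v : G.V) (e : G.E) : Prop := v ∈ G.ends e

/-- Adjacency of vertices. -/
def Adj (u v : G.V) : Prop := u ≠ v ∧ ∃ e, G.ends e = s(u, v)

/-- A multigraph is connected. -/
def Connected : Prop := Nonempty G.V ∧ ∀ u v : G.V, Relation.ReflTransGen G.Adj u v

/-- A set of edges is a perfect matching: every vertex is covered exactly once. -/
def IsPerfectMatching (M : Set G.E) : Prop :=
  ∀ v : G.V, ∃! e, e ∈ M ∧ G.Inc v e

/-- Matching covered: nontrivial, connected, every edge lies in a perfect matching. -/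
def MatchingCovered : Prop :=
  2 ≤ Nat.card G.V ∧ G.Connected ∧ ∀ e : G.E, ∃ M, G.IsPerfectMatching M ∧ e ∈ M

/-- Degree of a vertex. -/
noncomputable def degree (v : G.V) : ℕ := Nat.card {e : G.E // G.Inc v e}

/-- Maximum degree `Δ(G)`. -/
noncomputable def maxDegree : ℕ := Finset.univ.sup G.degree

/-- The graph obtained by deleting the edge `e`. -/
noncomputable def deleteEdge (e : G.E) : Multigraph where
  V := G.V
  E := {f : G.E // f ≠ e}
  fintE := Fintype.ofFinite _
  ends f := G.ends f.1
  no_loops f := G.no_loops f.1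

/-- An edge of `G` is removable if `G - e` is matching covered. -/
noncomputable def Removable (e : G.E) : Prop := (G.deleteEdge e).MatchingCovered

/-- The graph obtained by deleting a set of vertices (and all incident edges). -/
noncomputable def deleteVerts (S : Set G.V) : Multigraph where
  V := {v : G.V // v ∉ S}
  E := {e : G.E // ∀ v ∈ G.ends e, v ∉ S}
  fintV := Fintype.ofFinite _
  fintE := Fintype.ofFinite _
  ends e := (G.ends e.1).attachWith e.2
  no_loops e h := G.no_loops e.1 (by
    have := (Sym2.isDiag_map Subtype.val_injective).mpr h
    simpa using this)

/-- Two-connectedness: at least three vertices, and deleting any vertex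
leaves a connected graph. -/
noncomputable def TwoConnected : Prop :=
  3 ≤ Nat.card G.V ∧ ∀ v : G.V, (G.deleteVerts {v}).Connected

/-- Three-connectedness: at least four vertices, and deleting any two distinct
vertices leaves a connected graph. -/
noncomputable def ThreeConnected : Prop :=
  4 ≤ Nat.card G.V ∧ ∀ u v : G.V, u ≠ v → (G.deleteVerts {u, v}).Connected

/-- The cut `∂(X)`: edges with exactly one end in `X`. -/
def cut (X : Set G.V) : Set G.E :=
  {e | ∃ u ∈ X, ∃ w ∈ Xᶜ, G.ends e = s(u, w)}

/-- A tight cut: a cut (with both shores nonempty) met by every perfect matching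
in exactly one edge. -/
def IsTightCut (X : Set G.V) : Prop :=
  X.Nonempty ∧ Xᶜ.Nonempty ∧
    ∀ M : Set G.E, G.IsPerfectMatching M → ∃! e, e ∈ M ∧ e ∈ G.cut X

/-- A cut `∂(X)` is trivial if one of its shores is a singleton. -/
def TrivialShore (X : Set G.V) : Prop := (∃ v, X = {v}) ∨ (∃ v, Xᶜ = {v})

/-- `G` is bipartite. -/
def Bipartite : Prop :=
  ∃ c : G.V → Bool, ∀ (e : G.E) (a b : G.V), G.ends e = s(a, b) → c a ≠ c b

/-- The subgraph of `G` induced by `X` is bipartite. -/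
def BipartiteOn (X : Set G.V) : Prop :=
  ∃ c : G.V → Bool, ∀ (e : G.E) (a b : G.V),
    G.ends e = s(a, b) → a ∈ X → b ∈ X → c a ≠ c b

lemma Sym2.exists_eq_mk {α : Type*} (z : Sym2 α) : ∃ a b, z = s(a, b) := by
  induction z using Sym2.ind with
  | _ x y => exact ⟨x, y, rfl⟩

open Classical in
/-- Contraction `G/X`: the shore `X` is shrunk to a single new vertex.
Edges with both ends in `X` disappear. -/
noncomputable def contract (X : Set G.V) : Multigraph where
  V := {v : G.V // v ∉ X} ⊕ Unit
  E := {e : G.E // ¬ ∀ v ∈ G.ends e, v ∈ X}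
  fintV := Fintype.ofFinite _
  fintE := Fintype.ofFinite _
  ends e := (G.ends e.1).map
    (fun v => if h : v ∈ X then Sum.inr () else Sum.inl ⟨v, h⟩)
  no_loops := by
    rintro ⟨e, he⟩ hdiag
    obtain ⟨a, b, hab⟩ := Sym2.exists_eq_mk (G.ends e)
    have hne : a ≠ b := by
      have := G.no_loops e
      rw [hab, Sym2.mk_isDiag_iff] at this
      exact this
    simp only [hab, Sym2.map_pair_eq, Sym2.mk_isDiag_iff] at hdiag
    by_cases ha : a ∈ X <;> by_cases hb : b ∈ X
    · exact he (by
        rw [hab]; intro v hv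
        rcases Sym2.mem_iff.mp hv with h | h <;> subst h <;> assumption)
    · rw [dif_pos ha, dif_neg hb] at hdiag; simp at hdiag
    · rw [dif_neg ha, dif_pos hb] at hdiag; simp at hdiag
    · rw [dif_neg ha, dif_neg hb] at hdiag
      simp only [Sum.inl.injEq, Subtype.mk.injEq] at hdiag
      exact hne hdiag

/-- A brick: a nonbipartite matching covered graph all of whose tight cuts are
trivial. -/
def IsBrick : Prop :=
  G.MatchingCovered ∧ ¬ G.Bipartite ∧ ∀ X : Set G.V, G.IsTightCut X → G.TrivialShore X

/-- A brace: a bipartite matching covered graph all of whose tight cuts are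
trivial. -/
def IsBrace : Prop :=
  G.MatchingCovered ∧ G.Bipartite ∧ ∀ X : Set G.V, G.IsTightCut X → G.TrivialShore X

/-- `BrickCount G n` holds if some tight cut decomposition of `G` produces
exactly `n` bricks.  (By Lovász's theorem the number `n` is independent of the
decomposition.) -/
inductive BrickCount : (G : Multigraph) → ℕ → Prop
  | brick (G : Multigraph) (h : G.IsBrick) : BrickCount G 1
  | brace (G : Multigraph) (h : G.IsBrace) : BrickCount G 0
  | cut (G : Multigraph) (X : Set G.V) (ht : G.IsTightCut X) (hnt : ¬ G.TrivialShore X)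
      {n m : ℕ} (h1 : BrickCount (G.contract X) n) (h2 : BrickCount (G.contract Xᶜ) m) :
      BrickCount G (n + m)

/-- A near-brick: a matching covered graph whose tight cut decompositions
have exactly one brick. -/
def IsNearBrick : Prop := G.MatchingCovered ∧ BrickCount G 1

/-- A single ear of length at least 3: an odd path of length `k ≥ 3` all of whose
internal vertices have degree two. -/
def HasLongSingleEar : Prop :=
  ∃ (k : ℕ) (v : Fin (k + 1) → G.V) (e : Fin k → G.E),
    Odd k ∧ 3 ≤ k ∧ Function.Injective v ∧ Function.Injective e ∧
    (∀ i : Fin k, G.ends (e i) = s(v i.castSucc, v i.succ)) ∧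
    (∀ i : Fin (k + 1), i ≠ 0 → i ≠ Fin.last k → G.degree (v i) = 2)

/-- Irreducible: no single ear of length three or more. -/
def Irreducible : Prop := ¬ G.HasLongSingleEar

/-- Isomorphism of multigraphs. -/
def IsIso (G H : Multigraph) : Prop :=
  ∃ (φ : G.V ≃ H.V) (ψ : G.E ≃ H.E), ∀ e, H.ends (ψ e) = (G.ends e).map φ

end Multigraph

open Multigraph

/-- The complete graph `K₂`. -/
def K2 : Multigraph where
  V := Fin 2
  E := Unit
  ends _ := s(0, 1)
  no_loops _ := by simp [Sym2.mk_isDiag_iff]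

/-- The complete graph `K₄`. -/
noncomputable def K4 : Multigraph where
  V := Fin 4
  E := {p : Sym2 (Fin 4) // ¬ p.IsDiag}
  fintE := Fintype.ofFinite _
  ends p := p.1
  no_loops p := p.2

/-- The cycle `C₄`. -/
def C4 : Multigraph where
  V := ZMod 4
  E := ZMod 4
  ends i := s(i, i + 1)
  no_loops i := by
    have h : ∀ j : ZMod 4, j ≠ j + 1 := by decide
    simpa [Sym2.mk_isDiag_iff] using h i

/-- `C̄₆`, the complement of the 6-cycle (the triangular prism). -/
noncomputable def C6bar : Multigraph where
  V := ZMod 6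
  E := {p : Sym2 (ZMod 6) // ¬ p.IsDiag ∧ ∀ a b : ZMod 6, p = s(a, b) → b ≠ a + 1 ∧ a ≠ b + 1}
  fintE := Fintype.ofFinite _
  ends p := p.1
  no_loops p := p.2.1

namespace Multigraph

section Pairings

variable {G : Multigraph}

lemma adj_of_ends {e : G.E} {u v : G.V} (h : G.ends e = s(u, v)) : G.Adj u v := by
  refine ⟨fun huv => G.no_loops e ?_, e, h⟩
  rw [h, huv]
  exact Sym2.mk_isDiag_iff.mpr rfl

lemma Adj.symm {u v : G.V} (h : G.Adj u v) : G.Adj v u := by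
  obtain ⟨hne, e, he⟩ := h
  exact ⟨hne.symm, e, he.trans Sym2.eq_swap⟩

/-- A perfect matching of the underlying simple graph, seen as an involution
sending every vertex to a neighbour. -/
def IsPairing (G : Multigraph) (σ : G.V → G.V) : Prop :=
  ∀ v, σ (σ v) = v ∧ G.Adj v (σ v)

lemma IsPairing.injective {σ : G.V → G.V} (h : G.IsPairing σ) : Function.Injective σ :=
  Function.LeftInverse.injective (g := σ) fun v => (h v).1

lemma IsPerfectMatching.exists_pairing {M : Set G.E} (hM : G.IsPerfectMatching M) :
    ∃ σ, G.IsPairing σ ∧ ∀ e ∈ M, ∀ u v, G.ends e = s(u, v) → σ u = v := by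
  choose e he huniq using hM
  have hmem : ∀ v, ∃ w, G.ends (e v) = s(v, w) := fun v => Sym2.mem_iff_exists.mp (he v).2
  choose σ hσ using hmem
  have key : ∀ e' ∈ M, ∀ u v, G.ends e' = s(u, v) → σ u = v := by
    intro e' he' u v huv
    have hinc : G.Inc u e' := by
      unfold Inc
      rw [huv]
      exact Sym2.mem_mk_left u v
    have heq := huniq u e' ⟨he', hinc⟩
    rw [heq, hσ] at huv
    exact Sym2.congr_right.mp huv
  exact ⟨σ, fun v => ⟨key _ (he v).1 _ _ ((hσ v).trans Sym2.eq_swap), adj_of_ends (hσ v)⟩, key⟩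

lemma IsPairing.exists_perfectMatching {σ : G.V → G.V} (hσ : G.IsPairing σ)
    {e₀ : G.E} {u₀ : G.V} (h₀ : G.ends e₀ = s(u₀, σ u₀)) :
    ∃ M, G.IsPerfectMatching M ∧ e₀ ∈ M ∧
      ∀ e ∈ M, ∀ u v, G.ends e = s(u, v) → σ u = v := by
  classical
  have hF : ∀ z : Sym2 G.V, ∃ e, (z = G.ends e₀ → e = e₀) ∧
      ∀ e', G.ends e' = z → G.ends e = z := by
    intro z
    by_cases hz : z = G.ends e₀
    · exact ⟨e₀, fun _ => rfl, fun _ _ => hz.symm⟩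
    · by_cases hz' : ∃ e, G.ends e = z
      · obtain ⟨e, he⟩ := hz'
        exact ⟨e, fun h => absurd h hz, fun _ _ => he⟩
      · exact ⟨e₀, fun h => absurd h hz, fun e' he' => absurd ⟨e', he'⟩ hz'⟩
  choose F hF₀ hF using hF
  have hends : ∀ v, G.ends (F s(v, σ v)) = s(v, σ v) := by
    intro v
    obtain ⟨-, -, e, he⟩ := hσ v
    exact hF _ e he
  have hpair : ∀ u v w, s(w, σ w) = s(u, v) → σ u = v := by
    intro u v w h
    rcases Sym2.eq_iff.mp h with ⟨rfl, rfl⟩ | ⟨rfl, rfl⟩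
    · rfl
    · exact (hσ w).1
  refine ⟨Set.range fun v => F s(v, σ v), fun v => ?_, ⟨u₀, hF₀ _ h₀.symm⟩, ?_⟩
  · refine ⟨F s(v, σ v), ⟨⟨v, rfl⟩, ?_⟩, ?_⟩
    · unfold Inc
      rw [hends]
      exact Sym2.mem_mk_left _ _
    · rintro _ ⟨⟨w, rfl⟩, hw⟩
      unfold Inc at hw
      obtain ⟨v', hv'⟩ := Sym2.mem_iff_exists.mp hw
      simp only [hends] at hv'
      simp only [hv', hpair _ _ _ hv']
  · rintro _ ⟨w, rfl⟩ u v huv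
    simp only [hends] at huv
    exact hpair _ _ _ huv

lemma IsPerfectMatching.exists_edge {M : Set G.E} (hM : G.IsPerfectMatching M)
    {σ : G.V → G.V} (hσ : ∀ e ∈ M, ∀ u v, G.ends e = s(u, v) → σ u = v) (v : G.V) :
    ∃ e ∈ M, G.ends e = s(v, σ v) := by
  obtain ⟨e, ⟨heM, hinc⟩, -⟩ := hM v
  obtain ⟨w, hw⟩ := Sym2.mem_iff_exists.mp hinc
  exact ⟨e, heM, by rw [hw, hσ e heM v w hw]⟩

lemma isTightCut_iff {X : Set G.V} :
    G.IsTightCut X ↔ X.Nonempty ∧ Xᶜ.Nonempty ∧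
      ∀ σ, G.IsPairing σ → ∃! v, v ∈ X ∧ σ v ∉ X := by
  constructor
  · rintro ⟨hX, hXc, h⟩
    refine ⟨hX, hXc, fun σ hσ => ?_⟩
    obtain ⟨v₀, -⟩ := hX
    obtain ⟨-, -, e₀, he₀⟩ := hσ v₀
    obtain ⟨M, hM, -, hMσ⟩ := hσ.exists_perfectMatching he₀
    obtain ⟨e, ⟨heM, u, hu, w, hw, huw⟩, huniq⟩ := h M hM
    refine ⟨u, ⟨hu, (hMσ e heM u w huw).symm ▸ hw⟩, ?_⟩
    rintro v ⟨hv, hσv⟩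
    obtain ⟨e', he'M, he'⟩ := hM.exists_edge hMσ v
    have := huniq e' ⟨he'M, v, hv, σ v, hσv, he'⟩
    rw [this, huw] at he'
    rcases Sym2.eq_iff.mp he' with ⟨h1, -⟩ | ⟨-, h2⟩
    · exact h1.symm
    · exact absurd (h2 ▸ hv) hw
  · rintro ⟨hX, hXc, h⟩
    refine ⟨hX, hXc, fun M hM => ?_⟩
    obtain ⟨σ, hσ, hMσ⟩ := hM.exists_pairing
    obtain ⟨v, ⟨hv, hσv⟩, huniq⟩ := h σ hσ
    obtain ⟨e, heM, he⟩ := hM.exists_edge hMσ v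
    refine ⟨e, ⟨heM, v, hv, σ v, hσv, he⟩, ?_⟩
    rintro e' ⟨he'M, u, hu, w, hw, huw⟩
    have hσu : σ u = w := hMσ e' he'M u w huw
    have huv : u = v := huniq u ⟨hu, hσu.symm ▸ hw⟩
    subst huv
    refine (hM u).unique ⟨he'M, ?_⟩ ⟨heM, ?_⟩
    · unfold Inc
      rw [huw]
      exact Sym2.mem_mk_left _ _
    · unfold Inc
      rw [he]
      exact Sym2.mem_mk_left _ _

lemma matchingCovered_iff :
    G.MatchingCovered ↔ 2 ≤ Nat.card G.V ∧ G.Connected ∧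
      ∀ u v, G.Adj u v → ∃ σ, G.IsPairing σ ∧ σ u = v := by
  refine and_congr_right fun _ => and_congr_right fun _ => ⟨fun h u v => ?_, fun h e => ?_⟩
  · rintro ⟨-, e, he⟩
    obtain ⟨M, hM, heM⟩ := h e
    obtain ⟨σ, hσ, hMσ⟩ := hM.exists_pairing
    exact ⟨σ, hσ, hMσ e heM u v he⟩
  · obtain ⟨u, v, he⟩ := Sym2.exists_eq_mk (G.ends e)
    obtain ⟨σ, hσ, rfl⟩ := h u v (adj_of_ends he)
    obtain ⟨M, hM, heM, -⟩ := hσ.exists_perfectMatching he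
    exact ⟨M, hM, heM⟩

lemma bipartite_iff :
    G.Bipartite ↔ ∃ c : G.V → Bool, ∀ a b, G.Adj a b → c a ≠ c b :=
  ⟨fun ⟨c, hc⟩ => ⟨c, fun a b ⟨_, e, he⟩ => hc e a b he⟩,
    fun ⟨c, hc⟩ => ⟨c, fun _ a b he => hc a b (adj_of_ends he)⟩⟩

lemma IsTightCut.compl {X : Set G.V} (h : G.IsTightCut X) : G.IsTightCut Xᶜ := by
  obtain ⟨hX, hXc, h⟩ := isTightCut_iff.mp h
  refine isTightCut_iff.mpr ⟨hXc, by rwa [compl_compl], fun σ hσ => ?_⟩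
  obtain ⟨v, ⟨hv, hσv⟩, huniq⟩ := h σ hσ
  refine ⟨σ v, ⟨hσv, by rw [(hσ v).1]; exact fun h => h hv⟩, ?_⟩
  rintro w ⟨hw, hσw⟩
  rw [← huniq (σ w) ⟨not_not.mp hσw, by rw [(hσ w).1]; exact hw⟩, (hσ w).1]

lemma TrivialShore.compl {X : Set G.V} (h : G.TrivialShore X) : G.TrivialShore Xᶜ := by
  unfold TrivialShore at h ⊢
  rw [compl_compl]
  exact h.symm

lemma trivialShore_compl {X : Set G.V} : G.TrivialShore Xᶜ ↔ G.TrivialShore X :=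
  ⟨fun h => compl_compl X ▸ h.compl, TrivialShore.compl⟩

lemma nontrivial_of_not_trivialShore {X : Set G.V} (hX : X.Nonempty)
    (h : ¬ G.TrivialShore X) : X.Nontrivial := by
  obtain ⟨v, hv⟩ := hX
  by_contra hn
  rw [Set.not_nontrivial_iff] at hn
  exact h (Or.inl ⟨v, hn.eq_singleton_of_mem hv⟩)

lemma not_trivialShore_of_nontrivial {X : Set G.V} (hX : X.Nontrivial)
    (hXc : Xᶜ.Nontrivial) : ¬ G.TrivialShore X := by
  rintro (⟨v, hv⟩ | ⟨v, hv⟩)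
  · exact Set.not_nontrivial_singleton (hv ▸ hX)
  · exact Set.not_nontrivial_singleton (hv ▸ hXc)

lemma Connected.exists_adj_of_mem {A : Set G.V} (hG : G.Connected) {u v : G.V}
    (hu : u ∈ A) (hv : v ∉ A) : ∃ a ∈ A, ∃ b ∉ A, G.Adj a b := by
  by_contra! h
  refine hv ?_
  induction hG.2 u v with
  | refl => exact hu
  | tail _ hadj ih =>
    by_contra hc
    exact h _ (ih fun h' => hc (by tauto)) _ hc hadj

lemma MatchingCovered.exists_pairing (hG : G.MatchingCovered) : ∃ σ, G.IsPairing σ := by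
  obtain ⟨hcard, hconn, h⟩ := matchingCovered_iff.mp hG
  have : Nontrivial G.V := Finite.one_lt_card_iff_nontrivial.mp hcard
  obtain ⟨u, v, huv⟩ := exists_pair_ne G.V
  obtain ⟨a, -, b, -, hab⟩ := hconn.exists_adj_of_mem (A := {u}) rfl huv.symm
  obtain ⟨σ, hσ, -⟩ := h a b hab
  exact ⟨σ, hσ⟩

end Pairings

section Quotients

variable {G H K : Multigraph}

/-- `f` exhibits the underlying simple graph of `H` as a loopless quotient of that of `G`. -/
structure IsQuot (f : G.V → H.V) : Prop where
  surjective : Function.Surjective f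
  adj_iff : ∀ a b, H.Adj a b ↔ a ≠ b ∧ ∃ u v, f u = a ∧ f v = b ∧ G.Adj u v

lemma IsQuot.adj {f : G.V → H.V} (hf : IsQuot f) {u v : G.V} (h : G.Adj u v)
    (hne : f u ≠ f v) : H.Adj (f u) (f v) :=
  (hf.adj_iff _ _).mpr ⟨hne, u, v, rfl, rfl, h⟩

lemma IsQuot.comp {f : G.V → H.V} {g : H.V → K.V} (hg : IsQuot g) (hf : IsQuot f) :
    IsQuot (G := G) (H := K) (g ∘ f) := by
  refine ⟨hg.surjective.comp hf.surjective, fun a b => ⟨fun h => ?_, ?_⟩⟩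
  · obtain ⟨hne, a, b, rfl, rfl, hab⟩ := (hg.adj_iff a b).mp h
    obtain ⟨-, u, v, rfl, rfl, huv⟩ := (hf.adj_iff a b).mp hab
    exact ⟨hne, u, v, rfl, rfl, huv⟩
  · rintro ⟨hne, u, v, rfl, rfl, huv⟩
    exact hg.adj (hf.adj huv fun h => hne (congrArg g h)) hne

/-- Isomorphism of the underlying simple graphs. -/
def SimpleIso (G H : Multigraph) : Prop :=
  ∃ φ : G.V ≃ H.V, ∀ u v, G.Adj u v ↔ H.Adj (φ u) (φ v)

lemma SimpleIso.symm (h : SimpleIso G H) : SimpleIso H G := by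
  obtain ⟨φ, hφ⟩ := h
  exact ⟨φ.symm, fun u v => by simp [hφ]⟩

lemma isQuot_of_equiv {φ : G.V ≃ H.V} (hφ : ∀ u v, G.Adj u v ↔ H.Adj (φ u) (φ v)) :
    IsQuot (G := G) (H := H) φ := by
  refine ⟨φ.surjective, fun a b => ⟨fun h => ?_, ?_⟩⟩
  · exact ⟨h.1, φ.symm a, φ.symm b, by simp, by simp, by simpa [hφ] using h⟩
  · rintro ⟨-, u, v, rfl, rfl, h⟩
    exact (hφ u v).mp h

lemma isQuot_id : IsQuot (G := G) (H := G) id :=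
  isQuot_of_equiv (φ := Equiv.refl _) fun _ _ => Iff.rfl

lemma simpleIso_of_surjective {f : G.V → H.V} {g : G.V → K.V}
    (hf : Function.Surjective f) (hg : Function.Surjective g)
    (hker : ∀ u v, f u = f v ↔ g u = g v)
    (hadj : ∀ u v, H.Adj (f u) (f v) ↔ K.Adj (g u) (g v)) : SimpleIso H K := by
  have hs : ∀ u, g (Function.surjInv hf (f u)) = g u := fun u =>
    (hker _ _).mp (Function.surjInv_eq hf _)
  refine ⟨Equiv.ofBijective (fun a => g (Function.surjInv hf a)) ⟨fun a b h => ?_, fun c => ?_⟩,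
    fun a b => ?_⟩
  · simpa [Function.surjInv_eq] using (hker _ _).mpr h
  · obtain ⟨u, rfl⟩ := hg c
    exact ⟨f u, hs u⟩
  · obtain ⟨u, rfl⟩ := hf a
    obtain ⟨v, rfl⟩ := hf b
    change H.Adj (f u) (f v) ↔
      K.Adj (g (Function.surjInv hf (f u))) (g (Function.surjInv hf (f v)))
    rw [hs, hs, hadj]

lemma IsQuot.simpleIso {f : G.V → H.V} {g : G.V → K.V} (hf : IsQuot f) (hg : IsQuot g)
    (hker : ∀ u v, f u = f v ↔ g u = g v) : SimpleIso H K := by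
  refine simpleIso_of_surjective hf.surjective hg.surjective hker fun u v => ?_
  simp only [hf.adj_iff, hg.adj_iff, ne_eq, hker]

open Classical in
/-- The vertex map of the contraction of `X`. -/
noncomputable def proj (G : Multigraph) (X : Set G.V) : G.V → (G.contract X).V :=
  fun v => if h : v ∈ X then Sum.inr () else Sum.inl ⟨v, h⟩

/-- The vertex of the contraction of `X` that replaces `X`. -/
def shrunk (G : Multigraph) (X : Set G.V) : (G.contract X).V := Sum.inr ()

lemma proj_eq_shrunk_iff {X : Set G.V} {v : G.V} : G.proj X v = G.shrunk X ↔ v ∈ X := by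
  unfold proj shrunk
  change @Eq ({v : G.V // v ∉ X} ⊕ Unit) _ _ ↔ _
  split_ifs with h <;> simp [h]

lemma proj_eq_iff {X : Set G.V} {u v : G.V} :
    G.proj X u = G.proj X v ↔ u = v ∨ u ∈ X ∧ v ∈ X := by
  unfold proj
  change @Eq ({v : G.V // v ∉ X} ⊕ Unit) _ _ ↔ _
  by_cases hu : u ∈ X <;> by_cases hv : v ∈ X
  · simp [hu, hv]
  · simpa [hu, hv] using fun h : u = v => hv (h ▸ hu)
  · simpa [hu, hv] using fun h : u = v => hu (h ▸ hv)
  · simp [hu, hv]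

lemma eq_shrunk_or_exists {X : Set G.V} (a : (G.contract X).V) :
    a = G.shrunk X ∨ ∃ v ∉ X, G.proj X v = a := by
  rcases a with ⟨v, hv⟩ | ⟨⟩
  · exact Or.inr ⟨v, hv, dif_neg hv⟩
  · exact Or.inl rfl

lemma isQuot_proj {X : Set G.V} (hX : X.Nonempty) : IsQuot (G.proj X) := by
  constructor
  · intro a
    rcases eq_shrunk_or_exists a with rfl | ⟨v, -, hv⟩
    · exact ⟨hX.some, proj_eq_shrunk_iff.mpr hX.some_mem⟩
    · exact ⟨v, hv⟩
  · intro a b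
    constructor
    · rintro ⟨hne, ⟨e, he⟩, hab⟩
      refine ⟨hne, ?_⟩
      obtain ⟨u, v, huv⟩ := Sym2.exists_eq_mk (G.ends e)
      have hab : (G.ends e).map (G.proj X) = s(a, b) := hab
      rw [huv, Sym2.map_mk] at hab
      rcases Sym2.eq_iff.mp hab with ⟨h1, h2⟩ | ⟨h1, h2⟩
      · exact ⟨u, v, h1, h2, adj_of_ends huv⟩
      · exact ⟨v, u, h2, h1, (adj_of_ends huv).symm⟩
    · rintro ⟨hne, u, v, rfl, rfl, -, e, he⟩
      refine ⟨hne, ⟨e, fun h => hne ?_⟩, ?_⟩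
      · exact proj_eq_iff.mpr (Or.inr ⟨h u (by simp [he]), h v (by simp [he])⟩)
      · change (G.ends e).map (G.proj X) = _
        rw [he, Sym2.map_mk]

lemma card_contract_lt {X : Set G.V} (hX : X.Nontrivial) :
    Nat.card (G.contract X).V < Nat.card G.V := by
  rw [Nat.card_eq_fintype_card, Nat.card_eq_fintype_card]
  refine Fintype.card_lt_of_surjective_not_injective (G.proj X)
    (isQuot_proj hX.nonempty).surjective fun hinj => ?_
  obtain ⟨u, hu, v, hv, huv⟩ := hX
  exact huv (hinj (proj_eq_iff.mpr (Or.inr ⟨hu, hv⟩)))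

lemma IsQuot.connected {f : G.V → H.V} (hf : IsQuot f) (hG : G.Connected) : H.Connected := by
  obtain ⟨⟨v⟩, h⟩ := hG
  refine ⟨⟨f v⟩, fun a b => ?_⟩
  obtain ⟨u, rfl⟩ := hf.surjective a
  obtain ⟨w, rfl⟩ := hf.surjective b
  induction h u w with
  | refl => exact .refl
  | @tail x y _ hadj ih =>
    by_cases hxy : f x = f y
    · rwa [← hxy]
    · exact ih.tail (hf.adj hadj hxy)

end Quotients

section SimpleIso

variable {G H : Multigraph}

lemma IsPairing.map_equiv {φ : G.V ≃ H.V} (hφ : ∀ u v, G.Adj u v ↔ H.Adj (φ u) (φ v))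
    {σ : G.V → G.V} (hσ : G.IsPairing σ) : H.IsPairing fun a => φ (σ (φ.symm a)) :=
  fun a => ⟨by simp [(hσ _).1], by simpa using (hφ _ _).mp (hσ (φ.symm a)).2⟩

lemma MatchingCovered.of_simpleIso (hG : G.MatchingCovered) (h : SimpleIso G H) :
    H.MatchingCovered := by
  obtain ⟨φ, hφ⟩ := h
  obtain ⟨hcard, hconn, hG⟩ := matchingCovered_iff.mp hG
  refine matchingCovered_iff.mpr ⟨Nat.card_congr φ ▸ hcard,
    (isQuot_of_equiv hφ).connected hconn, fun a b hab => ?_⟩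
  obtain ⟨σ, hσ, hab⟩ := hG (φ.symm a) (φ.symm b) (by simpa [hφ] using hab)
  exact ⟨_, hσ.map_equiv hφ, by simp [hab]⟩

lemma IsTightCut.preimage_equiv {φ : G.V ≃ H.V}
    (hφ : ∀ u v, G.Adj u v ↔ H.Adj (φ u) (φ v)) {X : Set H.V} (hX : H.IsTightCut X) :
    G.IsTightCut (φ ⁻¹' X) := by
  obtain ⟨hne, hnec, hX⟩ := isTightCut_iff.mp hX
  refine isTightCut_iff.mpr ⟨hne.preimage φ.surjective, hnec.preimage φ.surjective,
    fun σ hσ => ?_⟩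
  obtain ⟨a, ⟨ha, hσa⟩, huniq⟩ := hX _ (hσ.map_equiv hφ)
  refine ⟨φ.symm a, ⟨by simpa using ha, hσa⟩, ?_⟩
  rintro v ⟨hv, hσv⟩
  rw [Equiv.eq_symm_apply]
  exact huniq _ ⟨hv, by simpa using hσv⟩

lemma trivialShore_preimage_equiv (φ : G.V ≃ H.V) {X : Set H.V} :
    G.TrivialShore (φ ⁻¹' X) ↔ H.TrivialShore X := by
  have key : ∀ Y : Set H.V, (∃ v, φ ⁻¹' Y = {v}) ↔ ∃ v, Y = {v} := by
    intro Y
    constructor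
    · rintro ⟨v, hv⟩
      exact ⟨φ v, by rw [← φ.image_preimage Y, hv, Set.image_singleton]⟩
    · rintro ⟨v, rfl⟩
      exact ⟨φ.symm v, by ext; simp [Equiv.eq_symm_apply]⟩
  unfold TrivialShore
  rw [← Set.preimage_compl, key, key]

lemma Bipartite.of_simpleIso (hG : G.Bipartite) (h : SimpleIso G H) : H.Bipartite := by
  obtain ⟨φ, hφ⟩ := h
  obtain ⟨c, hc⟩ := bipartite_iff.mp hG
  exact bipartite_iff.mpr ⟨fun a => c (φ.symm a), fun a b hab => hc _ _ (by simpa [hφ] using hab)⟩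

lemma forall_trivialShore_of_simpleIso (h : SimpleIso G H)
    (hG : ∀ X : Set G.V, G.IsTightCut X → G.TrivialShore X) (X : Set H.V)
    (hX : H.IsTightCut X) : H.TrivialShore X := by
  obtain ⟨φ, hφ⟩ := h
  exact (trivialShore_preimage_equiv φ).mp (hG _ (hX.preimage_equiv hφ))

lemma contract_simpleIso {φ : G.V ≃ H.V} (hφ : ∀ u v, G.Adj u v ↔ H.Adj (φ u) (φ v))
    {X : Set H.V} (hX : X.Nonempty) : SimpleIso (G.contract (φ ⁻¹' X)) (H.contract X) := by
  refine (isQuot_proj (hX.preimage φ.surjective)).simpleIso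
    ((isQuot_proj hX).comp (isQuot_of_equiv hφ)) fun u v => ?_
  simp [proj_eq_iff]

lemma BrickCount.of_simpleIso {n : ℕ} (hG : BrickCount G n) :
    ∀ {H : Multigraph}, SimpleIso G H → BrickCount H n := by
  induction hG with
  | brick G h =>
    exact fun i => .brick _ ⟨h.1.of_simpleIso i, fun hb => h.2.1 (hb.of_simpleIso i.symm),
      forall_trivialShore_of_simpleIso i h.2.2⟩
  | brace G h =>
    exact fun i => .brace _ ⟨h.1.of_simpleIso i, h.2.1.of_simpleIso i,
      forall_trivialShore_of_simpleIso i h.2.2⟩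
  | cut G X ht hnt _ _ ih₁ ih₂ =>
    intro H i
    obtain ⟨φ, hφ⟩ := i.symm
    have hX := ht.preimage_equiv hφ
    refine .cut H (φ ⁻¹' X) hX (fun h => hnt ((trivialShore_preimage_equiv φ).mp h))
      (ih₁ (contract_simpleIso hφ ht.1).symm) (ih₂ ?_)
    exact (contract_simpleIso hφ ht.2.1).symm

end SimpleIso

end Multigraph

namespace Multigraph

section Contraction

variable {G : Multigraph} {X Y : Set G.V}

lemma exists_section (a : G.V) (ha : a ∈ X) :
    ∃ r : (G.contract X).V → G.V,
      (∀ c, G.proj X (r c) = c) ∧ ∀ v, v ∉ X ∨ v = a → r (G.proj X v) = v := by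
  have h : ∀ c, ∃ v, G.proj X v = c ∧ (v ∈ X → v = a) := by
    intro c
    rcases eq_shrunk_or_exists c with rfl | ⟨v, hv, rfl⟩
    · exact ⟨a, proj_eq_shrunk_iff.mpr ha, fun _ => rfl⟩
    · exact ⟨v, rfl, fun h => absurd h hv⟩
  choose r hr hra using h
  refine ⟨r, hr, fun v hv => ?_⟩
  rcases proj_eq_iff.mp (hr (G.proj X v)) with h | ⟨h₁, h₂⟩
  · exact h
  · rw [hra _ h₁, hv.resolve_left (not_not.mpr h₂)]

/-- A perfect matching of `G` restricts to one of the contraction. -/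
lemma IsTightCut.exists_pairing_contract (hX : G.IsTightCut X) {σ : G.V → G.V}
    (hσ : G.IsPairing σ) :
    ∃ τ, (G.contract X).IsPairing τ ∧
      ∀ v, ¬ (v ∈ X ∧ σ v ∈ X) → τ (G.proj X v) = G.proj X (σ v) := by
  obtain ⟨hne, -, h⟩ := isTightCut_iff.mp hX
  obtain ⟨a, ⟨ha, hσa⟩, huniq⟩ := h σ hσ
  obtain ⟨r, hr, hr'⟩ := exists_section a ha
  have hgood : ∀ v, ¬ (v ∈ X ∧ σ v ∈ X) → r (G.proj X v) = v := by
    intro v hv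
    by_cases hvX : v ∈ X
    · exact hr' v (Or.inr (huniq v ⟨hvX, fun h => hv ⟨hvX, h⟩⟩))
    · exact hr' v (Or.inl hvX)
  have hrep : ∀ c, ¬ (r c ∈ X ∧ σ (r c) ∈ X) := by
    rintro c ⟨h₁, h₂⟩
    have hc : G.proj X a = c := by rw [← hr c, proj_eq_iff]; exact Or.inr ⟨ha, h₁⟩
    rw [← hc, hr' a (Or.inr rfl)] at h₂
    exact hσa h₂
  refine ⟨fun c => G.proj X (σ (r c)), fun c => ⟨?_, ?_⟩, fun v hv => ?_⟩
  · have : r (G.proj X (σ (r c))) = σ (r c) := by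
      refine hgood _ fun h => hrep c ?_
      rw [(hσ _).1] at h
      exact h.symm
    simp only [this, (hσ _).1, hr]
  · have hadj := (hσ (r c)).2
    have := (isQuot_proj hne).adj hadj fun h => by
      rcases proj_eq_iff.mp h with h | h
      exacts [hadj.1 h, hrep c h]
    rwa [hr] at this
  · simp only [hgood v hv]

/-- A perfect matching of the contraction lifts to one of `G`. -/
lemma IsTightCut.exists_pairing_lift (hX : G.IsTightCut X) (hG : G.MatchingCovered)
    {τ : (G.contract X).V → (G.contract X).V} (hτ : (G.contract X).IsPairing τ) :
    ∃ ρ, G.IsPairing ρ ∧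
      ∀ v, ¬ (v ∈ X ∧ ρ v ∈ X) → τ (G.proj X v) = G.proj X (ρ v) := by
  classical
  obtain ⟨hne, -, htight⟩ := isTightCut_iff.mp hX
  obtain ⟨-, -, hG⟩ := matchingCovered_iff.mp hG
  have hq := isQuot_proj hne
  obtain ⟨hb, a, b, ha', hb', hab⟩ := (hq.adj_iff _ _).mp (hτ (G.shrunk X)).2
  have ha : a ∈ X := proj_eq_shrunk_iff.mp ha'
  have hbX : b ∉ X := fun h => hb (by rw [← hb', proj_eq_shrunk_iff.mpr h])
  obtain ⟨σ, hσ, rfl⟩ := hG a b hab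
  have huniq : ∀ v, ¬ (v ∈ X ∧ σ v ∈ X) → v ∉ X ∨ v = a := by
    intro v hv
    by_cases hvX : v ∈ X
    · exact Or.inr ((htight σ hσ).unique ⟨hvX, fun h => hv ⟨hvX, h⟩⟩ ⟨ha, hbX⟩)
    · exact Or.inl hvX
  obtain ⟨r, hr, hr'⟩ := exists_section a ha
  have hra : ∀ c, r c ∈ X → c = G.shrunk X := fun c h => by
    rw [← hr c, proj_eq_shrunk_iff.mpr h]
  have hrs : r (G.shrunk X) = a := ha' ▸ hr' a (Or.inr rfl)
  have hrep : ∀ c, ¬ (r c ∈ X ∧ σ (r c) ∈ X) := by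
    rintro c ⟨h₁, h₂⟩
    rw [hra c h₁, hrs] at h₂
    exact hbX h₂
  let ρ : G.V → G.V := fun v => if v ∈ X ∧ σ v ∈ X then σ v else r (τ (G.proj X v))
  have hρ_bad : ∀ v, v ∈ X ∧ σ v ∈ X → ρ v = σ v := fun v hv => if_pos hv
  have hρ_good : ∀ v, ¬ (v ∈ X ∧ σ v ∈ X) → ρ v = r (τ (G.proj X v)) := fun v hv => if_neg hv
  refine ⟨ρ, fun v => ?_, fun v hv => ?_⟩
  · by_cases hv : v ∈ X ∧ σ v ∈ X
    · rw [hρ_bad v hv, hρ_bad (σ v) (by rw [(hσ v).1]; exact hv.symm)]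
      exact hσ v
    · rw [hρ_good v hv, hρ_good _ (hrep _), hr, (hτ _).1]
      refine ⟨hr' v (huniq v hv), ?_⟩
      by_cases hvX : v ∈ X
      · obtain rfl : v = a := (huniq v hv).resolve_left (not_not.mpr hvX)
        rwa [ha', ← hb', hr' _ (Or.inl hbX)]
      by_cases hrX : r (τ (G.proj X v)) ∈ X
      · have hs := hra _ hrX
        have hvb : G.proj X v = G.proj X (σ a) := by rw [hb', ← hs, (hτ _).1]
        obtain rfl : v = σ a := (proj_eq_iff.mp hvb).resolve_right fun h => hvX h.1
        rw [hs, hrs]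
        exact hab.symm
      · obtain ⟨-, u, w, hu, hw, huw⟩ := (hq.adj_iff _ _).mp (hτ (G.proj X v)).2
        obtain rfl : u = v := (proj_eq_iff.mp hu).resolve_right fun h => hvX h.2
        rw [← hr (τ _)] at hw
        obtain rfl := (proj_eq_iff.mp hw).resolve_right fun h => hrX h.2
        exact huw
  · have hv' : ¬ (v ∈ X ∧ σ v ∈ X) := fun h => hv (by rwa [hρ_bad v h])
    rw [hρ_good v hv', hr]

lemma IsTightCut.matchingCovered_contract (hX : G.IsTightCut X) (hG : G.MatchingCovered) :
    (G.contract X).MatchingCovered := by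
  obtain ⟨-, hconn, hG⟩ := matchingCovered_iff.mp hG
  have hq := isQuot_proj hX.1
  refine matchingCovered_iff.mpr ⟨?_, hq.connected hconn, fun a b hab => ?_⟩
  · obtain ⟨u, hu⟩ := hX.1
    obtain ⟨v, hv⟩ := hX.2.1
    have : Nontrivial (G.contract X).V := ⟨G.proj X u, G.proj X v, fun h => by
      rcases proj_eq_iff.mp h with rfl | h
      exacts [hv hu, hv h.2]⟩
    exact Finite.one_lt_card_iff_nontrivial.mpr this
  · obtain ⟨hne, u, v, rfl, rfl, huv⟩ := (hq.adj_iff _ _).mp hab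
    obtain ⟨σ, hσ, rfl⟩ := hG u v huv
    obtain ⟨τ, hτ, h⟩ := hX.exists_pairing_contract hσ
    exact ⟨τ, hτ, h u fun h => hne (proj_eq_iff.mpr (Or.inr h))⟩

lemma IsTightCut.of_preimage_proj (hX : G.IsTightCut X) (hG : G.MatchingCovered)
    {Z : Set (G.contract X).V} (hZ : G.IsTightCut (G.proj X ⁻¹' Z)) :
    (G.contract X).IsTightCut Z := by
  wlog hs : G.shrunk X ∉ Z generalizing Z
  · rw [← compl_compl Z]
    exact (this (Z := Zᶜ) hZ.compl fun h => hs h.elim).compl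
  obtain ⟨⟨u, hu⟩, ⟨w, hw⟩, h⟩ := isTightCut_iff.mp hZ
  refine isTightCut_iff.mpr ⟨⟨_, hu⟩, ⟨_, hw⟩, fun τ hτ => ?_⟩
  obtain ⟨ρ, hρ, hρτ⟩ := hX.exists_pairing_lift hG hτ
  have hnot : ∀ v, G.proj X v ∈ Z → v ∉ X := fun v hv hvX =>
    hs (proj_eq_shrunk_iff.mpr hvX ▸ hv)
  obtain ⟨v, ⟨hv, hρv⟩, huniq⟩ := h ρ hρ
  refine ⟨G.proj X v, ⟨hv, ?_⟩, ?_⟩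
  · rw [hρτ v fun h => hnot v hv h.1]
    exact hρv
  · rintro c ⟨hc, hτc⟩
    obtain ⟨v', rfl⟩ := (isQuot_proj hX.1).surjective c
    rw [hρτ v' fun h => hnot v' hc h.1] at hτc
    rw [huniq v' ⟨hc, hτc⟩]

/-- A tight cut containing `X` strictly in one shore survives in the contraction of `X`. -/
lemma IsTightCut.exists_preimage_proj_eq (hX : G.IsTightCut X) (hY : G.IsTightCut Y)
    (hG : G.MatchingCovered) (hXY : X ⊂ Y) (hnt : ¬ G.TrivialShore Y) :
    ∃ Z, (G.contract X).IsTightCut Z ∧ ¬ (G.contract X).TrivialShore Z ∧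
      G.proj X ⁻¹' Z = Y := by
  have hpre : G.proj X ⁻¹' (G.proj X '' Y) = Y := by
    refine (Set.subset_preimage_image _ _).antisymm' ?_
    rintro w ⟨v, hv, hvw⟩
    rcases proj_eq_iff.mp hvw with rfl | h
    exacts [hv, hXY.1 h.2]
  refine ⟨G.proj X '' Y, hX.of_preimage_proj hG (hpre.symm ▸ hY),
    not_trivialShore_of_nontrivial ?_ ?_, hpre⟩
  · obtain ⟨u, hu⟩ := hX.1
    obtain ⟨v, hv, hvX⟩ := Set.exists_of_ssubset hXY
    refine ⟨_, ⟨u, hXY.1 hu, rfl⟩, _, ⟨v, hv, rfl⟩, fun h => ?_⟩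
    rcases proj_eq_iff.mp h with rfl | h
    exacts [hvX hu, hvX h.2]
  · obtain ⟨u, hu, v, hv, huv⟩ :=
      nontrivial_of_not_trivialShore hY.2.1 (mt trivialShore_compl.mp hnt)
    rw [← hpre] at hu hv
    refine ⟨_, hu, _, hv, fun h => ?_⟩
    rcases proj_eq_iff.mp h with h | h
    · exact huv h
    · rw [hpre] at hu
      exact hu (hXY.1 h.1)

lemma contract_contract_simpleIso (hX : X.Nonempty) (hXY : X ⊆ Y)
    {Z : Set (G.contract X).V} (hZ : G.proj X ⁻¹' Z = Y) :
    SimpleIso ((G.contract X).contract Z) (G.contract Y) := by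
  have hYne : Y.Nonempty := hX.mono hXY
  have hZne : Z.Nonempty := Set.nonempty_of_nonempty_preimage (hZ.symm ▸ hYne)
  refine ((isQuot_proj hZne).comp (isQuot_proj hX)).simpleIso (isQuot_proj hYne) fun u v => ?_
  have hmem : ∀ w, G.proj X w ∈ Z ↔ w ∈ Y := fun w => by rw [← hZ, Set.mem_preimage]
  simp only [Function.comp_apply, proj_eq_iff, hmem]
  have := @hXY u
  have := @hXY v
  tauto

lemma contract_contract_comm (hX : X.Nonempty) (hY : Y.Nonempty)
    {Z : Set (G.contract X).V} {W : Set (G.contract Y).V}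
    (hZ : G.proj X ⁻¹' Z = Y) (hW : G.proj Y ⁻¹' W = X) :
    SimpleIso ((G.contract X).contract Z) ((G.contract Y).contract W) := by
  have hZne : Z.Nonempty := Set.nonempty_of_nonempty_preimage (hZ.symm ▸ hY)
  have hWne : W.Nonempty := Set.nonempty_of_nonempty_preimage (hW.symm ▸ hX)
  refine ((isQuot_proj hZne).comp (isQuot_proj hX)).simpleIso
    ((isQuot_proj hWne).comp (isQuot_proj hY)) fun u v => ?_
  have hZmem : ∀ w, G.proj X w ∈ Z ↔ w ∈ Y := fun w => by rw [← hZ, Set.mem_preimage]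
  have hWmem : ∀ w, G.proj Y w ∈ W ↔ w ∈ X := fun w => by rw [← hW, Set.mem_preimage]
  simp only [Function.comp_apply, proj_eq_iff, hZmem, hWmem]
  tauto

end Contraction

section Uncrossing

variable {G : Multigraph} {X Y : Set G.V}

lemma IsPairing.odd_ncard_iff {σ : G.V → G.V} (hσ : G.IsPairing σ) (S : Set G.V) :
    Odd S.ncard ↔ Odd {v | v ∈ S ∧ σ v ∉ S}.ncard := by
  classical
  have heven : Even {v | v ∈ S ∧ σ v ∈ S}.ncard := by
    rw [Set.ncard_eq_toFinset_card', ← ZMod.natCast_eq_zero_iff_even]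
    have := Finset.sum_involution (s := {v | v ∈ S ∧ σ v ∈ S}.toFinset)
      (f := fun _ => (1 : ZMod 2)) (fun v _ => σ v) (fun _ _ => by decide)
      (fun v _ _ => (hσ v).2.1.symm) (fun v hv => by simpa [(hσ v).1, and_comm] using hv)
      (fun v _ => (hσ v).1)
    simpa using this
  have hsum : S.ncard = {v | v ∈ S ∧ σ v ∈ S}.ncard + {v | v ∈ S ∧ σ v ∉ S}.ncard :=
    (Set.ncard_inter_add_ncard_sdiff_eq_ncard S (σ ⁻¹' S)).symm
  rw [hsum, Nat.odd_add]
  grind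

lemma IsTightCut.odd_ncard (hX : G.IsTightCut X) (hG : G.MatchingCovered) : Odd X.ncard := by
  obtain ⟨σ, hσ⟩ := hG.exists_pairing
  obtain ⟨a, ha, huniq⟩ := (isTightCut_iff.mp hX).2.2 σ hσ
  have : {v | v ∈ X ∧ σ v ∉ X} = {a} := Set.eq_singleton_iff_unique_mem.mpr ⟨ha, huniq⟩
  rw [hσ.odd_ncard_iff, this, Set.ncard_singleton]
  exact odd_one

lemma isTightCut_of_odd (hG : G.MatchingCovered) {S : Set G.V} (hS : Odd S.ncard)
    (h : ∀ σ, G.IsPairing σ → ∃ a b, ∀ v ∈ S, σ v ∉ S → v = a ∨ v = b) : G.IsTightCut S := by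
  have key : ∀ σ, G.IsPairing σ → ∃! v, v ∈ S ∧ σ v ∉ S := by
    intro σ hσ
    obtain ⟨a, b, hab⟩ := h σ hσ
    have hodd := (hσ.odd_ncard_iff S).mp hS
    have hle : {v | v ∈ S ∧ σ v ∉ S}.ncard ≤ 2 :=
      (Set.ncard_le_ncard (fun v hv => hab v hv.1 hv.2) (Set.toFinite {a, b})).trans
        ((Set.ncard_insert_le a {b}).trans (by rw [Set.ncard_singleton]))
    have hone : {v | v ∈ S ∧ σ v ∉ S}.ncard = 1 := by grind
    obtain ⟨c, hc⟩ := Set.ncard_eq_one.mp hone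
    obtain ⟨hc, huniq⟩ := Set.eq_singleton_iff_unique_mem.mp hc
    exact ⟨c, hc, huniq⟩
  obtain ⟨σ, hσ⟩ := hG.exists_pairing
  obtain ⟨v, ⟨hv, hσv⟩, -⟩ := key σ hσ
  exact isTightCut_iff.mpr ⟨⟨v, hv⟩, ⟨σ v, hσv⟩, key⟩

lemma IsTightCut.inter (hX : G.IsTightCut X) (hY : G.IsTightCut Y) (hG : G.MatchingCovered)
    (hodd : Odd (X ∩ Y).ncard) : G.IsTightCut (X ∩ Y) := by
  refine isTightCut_of_odd hG hodd fun σ hσ => ?_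
  obtain ⟨a, -, ha⟩ := (isTightCut_iff.mp hX).2.2 σ hσ
  obtain ⟨b, -, hb⟩ := (isTightCut_iff.mp hY).2.2 σ hσ
  refine ⟨a, b, fun v hv hσv => ?_⟩
  by_cases h : σ v ∈ X
  · exact Or.inr (hb v ⟨hv.2, fun h' => hσv ⟨h, h'⟩⟩)
  · exact Or.inl (ha v ⟨hv.1, h⟩)

lemma IsTightCut.union (hX : G.IsTightCut X) (hY : G.IsTightCut Y) (hG : G.MatchingCovered)
    (hodd : Odd (X ∩ Y).ncard) : G.IsTightCut (X ∪ Y) := by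
  refine isTightCut_of_odd hG ?_ fun σ hσ => ?_
  · have h := Set.ncard_union_add_ncard_inter X Y
    have := hX.odd_ncard hG
    have := hY.odd_ncard hG
    grind
  · obtain ⟨a, -, ha⟩ := (isTightCut_iff.mp hX).2.2 σ hσ
    obtain ⟨b, -, hb⟩ := (isTightCut_iff.mp hY).2.2 σ hσ
    refine ⟨a, b, fun v hv hσv => hv.imp (fun h => ha v ⟨h, ?_⟩) fun h => hb v ⟨h, ?_⟩⟩
    exacts [fun h' => hσv (Or.inl h'), fun h' => hσv (Or.inr h')]

lemma IsTightCut.not_adj_of_mem_diff (hX : G.IsTightCut X) (hY : G.IsTightCut Y)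
    (hG : G.MatchingCovered) (hodd : Odd (X ∩ Y).ncard) :
    ∀ p ∈ X \ Y, ∀ q ∈ Y \ X, ¬ G.Adj p q := by
  rintro p ⟨hpX, hpY⟩ q ⟨hqY, hqX⟩ hpq
  obtain ⟨σ, hσ, rfl⟩ := (matchingCovered_iff.mp hG).2.2 p q hpq
  obtain ⟨v, ⟨hv, hσv⟩, -⟩ := (isTightCut_iff.mp (hX.inter hY hG hodd)).2.2 σ hσ
  by_cases h : σ v ∈ X
  · have := ((isTightCut_iff.mp hY).2.2 σ hσ).unique ⟨hv.2, fun h' => hσv ⟨h, h'⟩⟩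
      ⟨hqY, by rwa [(hσ p).1]⟩
    exact hqX (this ▸ hv.1)
  · have := ((isTightCut_iff.mp hX).2.2 σ hσ).unique ⟨hv.1, h⟩ ⟨hpX, hqX⟩
    exact hpY (this ▸ hv.2)

section Corners

variable {u v : G.V}

lemma IsTightCut.exists_adj_corner (hX : G.IsTightCut X) (hG : G.MatchingCovered)
    (hu : X ∩ Y = {u}) (hXnt : X.Nontrivial) : ∃ a ∈ X \ Y, G.Adj a u := by
  have hu' : ∀ w, w ∈ X → w ∈ Y → w = u := fun w h₁ h₂ => hu.subset ⟨h₁, h₂⟩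
  have huXY : u ∈ X ∩ Y := hu.symm.subset rfl
  obtain ⟨a₀, ha₀, hne⟩ := hXnt.exists_ne u
  obtain ⟨-, hconn, hG⟩ := matchingCovered_iff.mp hG
  obtain ⟨a, ha, b, hb, hab⟩ := hconn.exists_adj_of_mem (A := X \ Y)
    (⟨ha₀, fun h => hne (hu' _ ha₀ h)⟩ : a₀ ∈ X \ Y) (fun h => h.2 huXY.2 : u ∉ X \ Y)
  by_cases hbX : b ∈ X
  · obtain rfl : b = u := hu' b hbX (by_contra fun h => hb ⟨hbX, h⟩)
    exact ⟨a, ha, hab⟩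
  obtain ⟨σ, hσ, rfl⟩ := hG a b hab
  have hσu : σ u ∈ X := by
    by_contra h
    have := ((isTightCut_iff.mp hX).2.2 σ hσ).unique ⟨huXY.1, h⟩ ⟨ha.1, hbX⟩
    exact ha.2 (this ▸ huXY.2)
  exact ⟨σ u, ⟨hσu, fun h => (hσ u).2.1 (hu' _ hσu h).symm⟩, (hσ u).2.symm⟩

open Classical in
lemma IsTightCut.adj_of_corners (hX : G.IsTightCut X) (hY : G.IsTightCut Y)
    (hG : G.MatchingCovered)
    (hu : X ∩ Y = {u}) (hv : (X ∪ Y)ᶜ = {v}) (hXnt : X.Nontrivial)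
    (hno : ∀ p ∈ X \ Y, ∀ q ∈ Y \ X, ¬ G.Adj p q) {p q : G.V}
    (hpq : (G.contract X).Adj (G.proj X p) (G.proj X q)) :
    (G.contract Yᶜ).Adj (G.proj Yᶜ (if p ∈ X then u else p))
      (G.proj Yᶜ (if q ∈ X then u else q)) := by
  have hu' : ∀ w, w ∈ X → w ∈ Y → w = u := fun w h₁ h₂ => hu.subset ⟨h₁, h₂⟩
  have huXY : u ∈ X ∩ Y := hu.symm.subset rfl
  have hv' : ∀ w, w ∉ X → w ∉ Y → w = v := fun w h₁ h₂ => hv.subset (by simp [h₁, h₂])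
  have hvXY : v ∉ X ∧ v ∉ Y := by simpa using hv.symm.subset rfl
  have hg := isQuot_proj hY.2.1
  have hcongr : ∀ w w', G.proj X w = G.proj X w' →
      (if w ∈ X then u else w) = if w' ∈ X then u else w' := by
    intro w w' h
    rcases proj_eq_iff.mp h with rfl | ⟨h₁, h₂⟩
    · rfl
    · rw [if_pos h₁, if_pos h₂]
  have hmixed : ∀ p q, p ∈ X → q ∉ X → G.Adj p q →
      (G.contract Yᶜ).Adj (G.proj Yᶜ u) (G.proj Yᶜ q) := by
    intro p q hp hq hpq
    have hne : ∀ w, w ≠ u → G.proj Yᶜ u ≠ G.proj Yᶜ w := by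
      intro w hw h
      rcases proj_eq_iff.mp h with h | h
      exacts [hw h.symm, h.1 huXY.2]
    by_cases hqY : q ∈ Y
    · obtain rfl : p = u := hu' p hp (by_contra fun h => hno p ⟨hp, h⟩ q ⟨hqY, hq⟩ hpq)
      exact hg.adj hpq (hne q hpq.1.symm)
    · obtain ⟨a, ha, hau⟩ := hX.exists_adj_corner hG hu hXnt
      have hqa : G.proj Yᶜ q = G.proj Yᶜ a := proj_eq_iff.mpr (Or.inr ⟨hqY, ha.2⟩)
      rw [hqa]
      exact hg.adj hau.symm (hne a hau.1)
  obtain ⟨hne, p', q', hp, hq, hpq⟩ := ((isQuot_proj hX.1).adj_iff _ _).mp hpq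
  rw [← hcongr _ _ hp, ← hcongr _ _ hq]
  rw [← hp, ← hq] at hne
  split_ifs with hpX hqX hqX
  · exact absurd (proj_eq_iff.mpr (Or.inr ⟨hpX, hqX⟩)) hne
  · exact hmixed _ _ hpX hqX hpq
  · exact (hmixed _ _ hqX hpX hpq.symm).symm
  · refine hg.adj hpq fun h => ?_
    rcases proj_eq_iff.mp h with h | h
    · exact hpq.1 h
    · exact hpq.1 ((hv' _ hpX h.1).trans (hv' _ hqX h.2).symm)

/-- If two crossing tight cuts have singletons as opposite corners, then shrinking `X` yields the
same graph, up to edge multiplicities, as shrinking the complement of `Y`. -/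
lemma IsTightCut.contract_simpleIso_of_corners (hX : G.IsTightCut X) (hY : G.IsTightCut Y)
    (hG : G.MatchingCovered)
    (hu : X ∩ Y = {u}) (hv : (X ∪ Y)ᶜ = {v}) (hXnt : X.Nontrivial) (hYnt : Yᶜ.Nontrivial)
    (hno : ∀ p ∈ X \ Y, ∀ q ∈ Y \ X, ¬ G.Adj p q) :
    SimpleIso (G.contract X) (G.contract Yᶜ) := by
  classical
  have huXY : u ∈ X ∩ Y := hu.symm.subset rfl
  have hv' : ∀ w, w ∉ X → w ∉ Y → w = v := fun w h₁ h₂ => hv.subset (by simp [h₁, h₂])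
  have hvXY : v ∉ X ∧ v ∉ Y := by simpa using hv.symm.subset rfl
  have hu₂ : Yᶜ ∩ Xᶜ = {v} := by rw [← hv, Set.compl_union, Set.inter_comm]
  have hv₂ : (Yᶜ ∪ Xᶜ)ᶜ = {u} := by
    rw [← hu, Set.compl_union, compl_compl, compl_compl, Set.inter_comm]
  have hno₂ : ∀ p ∈ Yᶜ \ Xᶜ, ∀ q ∈ Xᶜ \ Yᶜ, ¬ G.Adj p q := fun p hp q hq =>
    hno p ⟨not_not.mp hp.2, hp.1⟩ q ⟨not_not.mp hq.2, hq.1⟩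
  have hback : ∀ p [Decidable ((if p ∈ X then u else p) ∈ Yᶜ)],
      G.proj X (if (if p ∈ X then u else p) ∈ Yᶜ then v else if p ∈ X then u else p) =
        G.proj X p := by
    intro p _
    by_cases hp : p ∈ X
    · simp only [if_pos hp]
      rw [if_neg (fun h => h huXY.2)]
      exact proj_eq_iff.mpr (Or.inr ⟨huXY.1, hp⟩)
    · simp only [if_neg hp]
      split_ifs with h
      · rw [hv' p hp h]
      · rfl
  refine simpleIso_of_surjective (f := G.proj X)
    (g := fun w => G.proj Yᶜ (if w ∈ X then u else w)) (isQuot_proj hX.1).surjective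
    (fun c => ?_) (fun p q => ?_) fun p q => ⟨?_, fun h => ?_⟩
  · rcases eq_shrunk_or_exists c with rfl | ⟨w, hw, rfl⟩
    · exact ⟨v, (congrArg _ (if_neg hvXY.1)).trans (proj_eq_shrunk_iff.mpr hvXY.2)⟩
    · refine ⟨w, congrArg _ ?_⟩
      split_ifs with h
      · exact (hu.subset (⟨h, not_not.mp hw⟩ : w ∈ X ∩ Y)).symm
      · rfl
  · simp only [proj_eq_iff]
    have huY := huXY.2
    have huX := huXY.1
    have hp := hv' p
    have hq := hv' q
    grind
  · exact hX.adj_of_corners hY hG hu hv hXnt hno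
  · have := hY.compl.adj_of_corners hX.compl hG hu₂ hv₂ hYnt hno₂ h
    rw [compl_compl] at this
    rwa [hback, hback] at this

end Corners

end Uncrossing

section Counting

variable {G : Multigraph} {X Y : Set G.V} {n m : ℕ}

/-- `n` bricks are obtained by decomposing both contractions of the cut `∂(X)`. -/
def CutCount (G : Multigraph) (X : Set G.V) (n : ℕ) : Prop :=
  ∃ n₁ n₂, BrickCount (G.contract X) n₁ ∧ BrickCount (G.contract Xᶜ) n₂ ∧ n = n₁ + n₂

lemma CutCount.compl (h : G.CutCount X n) : G.CutCount Xᶜ n := by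
  obtain ⟨n₁, n₂, h₁, h₂, rfl⟩ := h
  exact ⟨n₂, n₁, h₂, by rwa [compl_compl], add_comm _ _⟩

lemma MatchingCovered.exists_brickCount (hG : G.MatchingCovered) : ∃ n, BrickCount G n := by
  induction hk : Nat.card G.V using Nat.strong_induction_on generalizing G with
  | _ k ih =>
    by_cases h : ∀ X : Set G.V, G.IsTightCut X → G.TrivialShore X
    · by_cases hb : G.Bipartite
      · exact ⟨0, .brace G ⟨hG, hb, h⟩⟩
      · exact ⟨1, .brick G ⟨hG, hb, h⟩⟩
    · push Not at h
      obtain ⟨X, ht, hnt⟩ := h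
      obtain ⟨n, hn⟩ := ih _
        (hk ▸ card_contract_lt (nontrivial_of_not_trivialShore ht.1 hnt))
        (ht.matchingCovered_contract hG) rfl
      obtain ⟨m, hm⟩ := ih _
        (hk ▸ card_contract_lt (nontrivial_of_not_trivialShore ht.2.1
          (mt trivialShore_compl.mp hnt)))
        (ht.compl.matchingCovered_contract hG) rfl
      exact ⟨n + m, .cut G X ht hnt hn hm⟩

lemma IsTightCut.exists_cutCount (hX : G.IsTightCut X) (hG : G.MatchingCovered) :
    ∃ n, G.CutCount X n := by
  obtain ⟨n, hn⟩ := (hX.matchingCovered_contract hG).exists_brickCount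
  obtain ⟨m, hm⟩ := (hX.compl.matchingCovered_contract hG).exists_brickCount
  exact ⟨n + m, n, m, hn, hm, rfl⟩

/-- The brick count is well defined on matching covered graphs smaller than `G`. -/
def UniqueBelow (G : Multigraph) : Prop :=
  ∀ H : Multigraph, H.MatchingCovered → Nat.card H.V < Nat.card G.V →
    ∀ n m, BrickCount H n → BrickCount H m → n = m

lemma UniqueBelow.contract_eq (hu : G.UniqueBelow) (hG : G.MatchingCovered)
    (hX : G.IsTightCut X) (hnt : ¬ G.TrivialShore X)
    (hn : BrickCount (G.contract X) n) (hm : BrickCount (G.contract X) m) : n = m :=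
  hu _ (hX.matchingCovered_contract hG)
    (card_contract_lt (nontrivial_of_not_trivialShore hX.1 hnt)) _ _ hn hm

lemma UniqueBelow.cutCount_eq_of_subset (hu : G.UniqueBelow) (hG : G.MatchingCovered)
    (hX : G.IsTightCut X) (hXnt : ¬ G.TrivialShore X)
    (hY : G.IsTightCut Y) (hYnt : ¬ G.TrivialShore Y) (hXY : X ⊆ Y)
    (hn : G.CutCount X n) (hm : G.CutCount Y m) : n = m := by
  obtain ⟨n₁, n₂, hn₁, hn₂, rfl⟩ := hn
  obtain ⟨m₁, m₂, hm₁, hm₂, rfl⟩ := hm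
  have hXnt' := mt trivialShore_compl.mp hXnt
  have hYnt' := mt trivialShore_compl.mp hYnt
  rcases hXY.eq_or_ssubset with rfl | hss
  · rw [hu.contract_eq hG hX hXnt hn₁ hm₁, hu.contract_eq hG hX.compl hXnt' hn₂ hm₂]
  obtain ⟨Z, hZ, hZnt, hZY⟩ := hX.exists_preimage_proj_eq hY hG hss hYnt
  obtain ⟨W, hW, hWnt, hWX⟩ := hY.compl.exists_preimage_proj_eq hX.compl hG
    (compl_lt_compl_iff_lt.mpr hss) hXnt'
  obtain ⟨c, hc⟩ := (hZ.compl.matchingCovered_contract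
    (hX.matchingCovered_contract hG)).exists_brickCount
  have hZ' : BrickCount ((G.contract X).contract Z) m₁ :=
    hm₁.of_simpleIso (contract_contract_simpleIso hX.1 hXY hZY).symm
  have hW' : BrickCount ((G.contract Yᶜ).contract W) n₂ :=
    hn₂.of_simpleIso
      (contract_contract_simpleIso hY.2.1 (Set.compl_subset_compl.mpr hXY) hWX).symm
  have hWc : BrickCount ((G.contract Yᶜ).contract Wᶜ) c :=
    hc.of_simpleIso (contract_contract_comm hX.1 hY.2.1 (by rw [Set.preimage_compl, hZY])
      (by rw [Set.preimage_compl, hWX, compl_compl]))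
  have h₁ := hu.contract_eq hG hX hXnt hn₁ (.cut _ Z hZ hZnt hZ' hc)
  have h₂ := hu.contract_eq hG hY.compl hYnt' hm₂ (.cut _ W hW hWnt hW' hWc)
  omega

lemma UniqueBelow.cutCount_eq_of_odd (hu : G.UniqueBelow) (hG : G.MatchingCovered)
    (hX : G.IsTightCut X) (hXnt : ¬ G.TrivialShore X)
    (hY : G.IsTightCut Y) (hYnt : ¬ G.TrivialShore Y) (hodd : Odd (X ∩ Y).ncard)
    (hn : G.CutCount X n) (hm : G.CutCount Y m) : n = m := by
  have hXnt' := mt trivialShore_compl.mp hXnt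
  have hYnt' := mt trivialShore_compl.mp hYnt
  have hI := hX.inter hY hG hodd
  have hU := hX.union hY hG hodd
  by_cases hInt : G.TrivialShore (X ∩ Y)
  swap
  · obtain ⟨k, hk⟩ := hI.exists_cutCount hG
    rw [← hu.cutCount_eq_of_subset hG hI hInt hX hXnt Set.inter_subset_left hk hn,
      ← hu.cutCount_eq_of_subset hG hI hInt hY hYnt Set.inter_subset_right hk hm]
  by_cases hUnt : G.TrivialShore (X ∪ Y)
  swap
  · obtain ⟨k, hk⟩ := hU.exists_cutCount hG
    rw [hu.cutCount_eq_of_subset hG hX hXnt hU hUnt Set.subset_union_left hn hk,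
      hu.cutCount_eq_of_subset hG hY hYnt hU hUnt Set.subset_union_right hm hk]
  have hXn := nontrivial_of_not_trivialShore hX.1 hXnt
  have hYn := nontrivial_of_not_trivialShore hY.1 hYnt
  have hXn' := nontrivial_of_not_trivialShore hX.2.1 hXnt'
  have hYn' := nontrivial_of_not_trivialShore hY.2.1 hYnt'
  obtain ⟨u, hIu⟩ : ∃ u, X ∩ Y = {u} := hInt.resolve_right fun ⟨w, hw⟩ =>
    Set.not_nontrivial_singleton
      (hw ▸ hXn'.mono (Set.compl_subset_compl.mpr Set.inter_subset_left))
  obtain ⟨v, hUv⟩ : ∃ v, (X ∪ Y)ᶜ = {v} := hUnt.resolve_left fun ⟨w, hw⟩ =>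
    Set.not_nontrivial_singleton (hw ▸ hXn.mono Set.subset_union_left)
  have hno := hX.not_adj_of_mem_diff hY hG hodd
  have i₁ := hX.contract_simpleIso_of_corners hY hG hIu hUv hXn hYn' hno
  have i₂ := hY.contract_simpleIso_of_corners hX hG (Set.inter_comm X Y ▸ hIu)
    (Set.union_comm X Y ▸ hUv) hYn hXn' fun p hp q hq h => hno q hq p hp h.symm
  obtain ⟨n₁, n₂, hn₁, hn₂, rfl⟩ := hn
  obtain ⟨m₁, m₂, hm₁, hm₂, rfl⟩ := hm
  rw [hu.contract_eq hG hX hXnt hn₁ (hm₂.of_simpleIso i₁.symm),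
    hu.contract_eq hG hY hYnt hm₁ (hn₂.of_simpleIso i₂.symm), add_comm]

lemma UniqueBelow.cutCount_eq (hu : G.UniqueBelow) (hG : G.MatchingCovered)
    (hX : G.IsTightCut X) (hXnt : ¬ G.TrivialShore X)
    (hY : G.IsTightCut Y) (hYnt : ¬ G.TrivialShore Y)
    (hn : G.CutCount X n) (hm : G.CutCount Y m) : n = m := by
  by_cases hodd : Odd (X ∩ Y).ncard
  · exact hu.cutCount_eq_of_odd hG hX hXnt hY hYnt hodd hn hm
  · refine hu.cutCount_eq_of_odd hG hX hXnt hY.compl (mt trivialShore_compl.mp hYnt) ?_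
      hn hm.compl
    have h := Set.ncard_inter_add_ncard_sdiff_eq_ncard X Y
    rw [Set.sdiff_eq] at h
    have := hX.odd_ncard hG
    grind

/-- Lovász's theorem: any two tight cut decompositions have the same number of bricks. -/
theorem BrickCount.unique (hG : G.MatchingCovered) (hn : BrickCount G n)
    (hm : BrickCount G m) : n = m := by
  induction hk : Nat.card G.V using Nat.strong_induction_on generalizing G n m with
  | _ k ih =>
    have hu : G.UniqueBelow := fun H hH hlt n m hn hm => ih _ (hk ▸ hlt) hH hn hm rfl
    cases hn with
    | brick _ h =>
      cases hm with
      | brick => rfl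
      | brace _ h' => exact absurd h'.2.1 h.2.1
      | cut _ X ht hnt => exact absurd (h.2.2 X ht) hnt
    | brace _ h =>
      cases hm with
      | brick _ h' => exact absurd h.2.1 h'.2.1
      | brace => rfl
      | cut _ X ht hnt => exact absurd (h.2.2 X ht) hnt
    | cut _ X ht hnt h₁ h₂ =>
      cases hm with
      | brick _ h => exact absurd (h.2.2 X ht) hnt
      | brace _ h => exact absurd (h.2.2 X ht) hnt
      | cut _ Y ht' hnt' h₁' h₂' =>
        exact hu.cutCount_eq hG ht hnt ht' hnt' ⟨_, _, h₁, h₂, rfl⟩ ⟨_, _, h₁', h₂', rfl⟩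

lemma isBrace_of_card_eq_two (hG : G.MatchingCovered) (hcard : Nat.card G.V = 2) :
    G.IsBrace := by
  classical
  obtain ⟨x, y, hxy, huniv⟩ := Nat.card_eq_two_iff.mp hcard
  have hall : ∀ w, w = x ∨ w = y := fun w => huniv.symm.subset (Set.mem_univ w)
  refine ⟨hG, bipartite_iff.mpr ⟨fun w => decide (w = x), fun a b hab => ?_⟩, fun Z hZ => ?_⟩
  · have hne := hab.1
    rcases hall a with rfl | rfl <;> rcases hall b with rfl | rfl <;> simp [hne, hne.symm] at hne ⊢
  · obtain ⟨a, ha⟩ := hZ.1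
    obtain ⟨b, hb⟩ := hZ.2.1
    refine Or.inl ⟨a, Set.eq_singleton_iff_unique_mem.mpr ⟨ha, fun w hw => ?_⟩⟩
    have hab : a ≠ b := fun h => hb (h ▸ ha)
    have hwb : w ≠ b := fun h => hb (h ▸ hw)
    have := hall a
    have := hall b
    have := hall w
    grind

lemma contract_singleton_simpleIso (v : G.V) : SimpleIso (G.contract {v}) G := by
  refine (isQuot_proj (Set.singleton_nonempty v)).simpleIso isQuot_id fun a b => ?_
  rw [proj_eq_iff, id, id]
  refine ⟨?_, Or.inl⟩
  rintro (h | ⟨rfl, rfl⟩)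
  exacts [h, rfl]

lemma IsTightCut.brickCount_contract_compl_singleton (hG : G.MatchingCovered) {v : G.V}
    (ht : G.IsTightCut {v}) (hn : BrickCount (G.contract {v}ᶜ) n) : n = 0 := by
  have hMC := ht.compl.matchingCovered_contract hG
  refine hn.unique hMC (.brace _ (isBrace_of_card_eq_two hMC ?_))
  refine Nat.card_eq_two_iff.mpr ⟨G.proj {v}ᶜ v, G.shrunk {v}ᶜ, ?_, ?_⟩
  · rw [ne_eq, proj_eq_shrunk_iff]
    exact fun h => h rfl
  · refine Set.eq_univ_of_forall fun c => ?_
    rcases eq_shrunk_or_exists c with rfl | ⟨w, hw, rfl⟩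
    · exact Or.inr rfl
    · exact Or.inl (congrArg _ (not_not.mp hw))

lemma IsTightCut.brickCount_eq_of_singleton (hG : G.MatchingCovered) {v : G.V}
    (ht : G.IsTightCut {v}) (hn : BrickCount G n) {n₁ n₂ : ℕ}
    (h₁ : BrickCount (G.contract {v}) n₁) (h₂ : BrickCount (G.contract {v}ᶜ) n₂) :
    n = n₁ + n₂ := by
  rw [ht.brickCount_contract_compl_singleton hG h₂, add_zero]
  exact hn.unique hG (h₁.of_simpleIso (contract_singleton_simpleIso v))

end Counting

end Multigraph

/-- For a tight cut `C = ∂(X)` of a matching covered graph `G`, both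
`C`-contractions are matching covered and `b(G) = b(G/X̄) + b(G/X)`
(the brick numbers of tight cut decompositions add up). -/
theorem brickCount_tight_cut_additive
    (G : Multigraph) (hG : G.MatchingCovered) (X : Set G.V) (ht : G.IsTightCut X) :
    (G.contract X).MatchingCovered ∧ (G.contract Xᶜ).MatchingCovered ∧
      ∀ n n₁ n₂ : ℕ, Multigraph.BrickCount G n →
        Multigraph.BrickCount (G.contract X) n₁ →
        Multigraph.BrickCount (G.contract Xᶜ) n₂ → n = n₁ + n₂ := by
  refine ⟨ht.matchingCovered_contract hG, ht.compl.matchingCovered_contract hG,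
    fun n n₁ n₂ hn h₁ h₂ => ?_⟩
  by_cases hX : G.TrivialShore X
  · rcases hX with ⟨v, rfl⟩ | ⟨v, hv⟩
    · exact ht.brickCount_eq_of_singleton hG hn h₁ h₂
    · have htc := ht.compl
      rw [← compl_compl X] at h₁
      rw [hv] at htc h₁ h₂
      rw [htc.brickCount_eq_of_singleton hG hn h₂ h₁, add_comm]
  · exact hn.unique hG (.cut G X ht hX h₁ h₂)
end

section
/- Let H be a bisubdivision of a graph G at an edge e, and suppose H is matching covered. Then b(G) = b(H), i.e., G and H have the same number of bricks in their tight cut decompositions. -/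
open Multigraph

namespace Multigraph

/-- Data witnessing that `H` is a bisubdivision of `G` at the edge `e = uv`:
`H` is obtained from `G` by replacing `e` by an odd path `p 0, p 1, …, p k`
(`k ≥ 3` odd) from `u` to `v` whose internal vertices are new vertices of
degree two in `H`; the other vertices and edges of `G` are carried over by the
injections `φ` and `ψ`. -/
structure BisubWitness (H G : Multigraph) (e : G.E) where
  u : G.V
  v : G.V
  k : ℕ
  φ : G.V → H.V
  ψ : {f : G.E // f ≠ e} → H.E
  p : Fin (k + 1) → H.V
  q : Fin k → H.E
  ends_e : G.ends e = s(u, v)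
  odd : Odd k
  len : 3 ≤ k
  φ_inj : Function.Injective φ
  ψ_inj : Function.Injective ψ
  p_inj : Function.Injective p
  q_inj : Function.Injective q
  ψ_ends : ∀ f, H.ends (ψ f) = (G.ends f.1).map φ
  p_first : p 0 = φ u
  p_last : p (Fin.last k) = φ v
  q_ends : ∀ i : Fin k, H.ends (q i) = s(p i.castSucc, p i.succ)
  internal_new : ∀ i : Fin (k + 1), i ≠ 0 → i ≠ Fin.last k → p i ∉ Set.range φ
  internal_deg : ∀ i : Fin (k + 1), i ≠ 0 → i ≠ Fin.last k → H.degree (p i) = 2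
  v_cover : Set.range φ ∪ Set.range p = Set.univ
  e_cover : Set.range ψ ∪ Set.range q = Set.univ
  ψq_disj : ∀ f i, ψ f ≠ q i

/-- `H` is a bisubdivision of `G` at the edge `e`. -/
def IsBisubdivisionAt (H G : Multigraph) (e : G.E) : Prop :=
  Nonempty (BisubWitness H G e)

end Multigraph

namespace SimpleGraph

variable {V W : Type}

/-- A perfect matching of a simple graph, given as the involution exchanging matched vertices. -/
structure IsMatchingInvolution (G : SimpleGraph V) (σ : V → V) : Prop where
  adj : ∀ v, G.Adj v (σ v)
  invol : ∀ v, σ (σ v) = v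

/-- Nontrivial, connected, and every edge lies in a perfect matching. -/
structure IsMatchingCovered (G : SimpleGraph V) : Prop where
  nontrivial : Nontrivial V
  preconnected : G.Preconnected
  exists_matching : ∀ u v, G.Adj u v → ∃ σ, G.IsMatchingInvolution σ ∧ σ u = v

/-- The cut of `X` is tight: every perfect matching meets it in exactly one edge. -/
structure IsTight (G : SimpleGraph V) (X : Set V) : Prop where
  nonempty : X.Nonempty
  compl_nonempty : Xᶜ.Nonempty
  existsUnique : ∀ σ, G.IsMatchingInvolution σ → ∃! u, u ∈ X ∧ σ u ∉ X

/-- Two-colourability. -/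
def HasBoolColoring (G : SimpleGraph V) : Prop :=
  ∃ c : V → Bool, ∀ a b, G.Adj a b → c a ≠ c b

/-- The graph `K` is the quotient of `G` along `f`, with loops and multiplicities discarded. -/
structure IsQuotient (G : SimpleGraph V) (K : SimpleGraph W) (f : V → W) : Prop where
  surjective : Function.Surjective f
  adj_iff : ∀ c d, K.Adj c d ↔ c ≠ d ∧ ∃ a b, f a = c ∧ f b = d ∧ G.Adj a b

/-- The graph `K` is obtained from `G` by contracting the set `X` to a vertex. -/
structure IsContraction (G : SimpleGraph V) (X : Set V) (K : SimpleGraph W) (f : V → W) : Prop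
    extends G.IsQuotient K f where
  eq_iff : ∀ a b, f a = f b ↔ a = b ∨ (a ∈ X ∧ b ∈ X)

/-- All tight cuts are trivial. -/
def NoNontrivialTight (G : SimpleGraph V) : Prop :=
  ∀ X, G.IsTight X → ¬ (X.Nontrivial ∧ Xᶜ.Nontrivial)

/-- Some tight cut decomposition of `G` has exactly `n` bricks. -/
inductive HasBrickCount : {V : Type} → SimpleGraph V → ℕ → Prop
  | brick {V : Type} (G : SimpleGraph V) (hG : G.IsMatchingCovered) (hb : ¬ G.HasBoolColoring)
      (ht : G.NoNontrivialTight) : HasBrickCount G 1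
  | brace {V : Type} (G : SimpleGraph V) (hG : G.IsMatchingCovered) (hb : G.HasBoolColoring)
      (ht : G.NoNontrivialTight) : HasBrickCount G 0
  | cut {V W₁ W₂ : Type} (G : SimpleGraph V) (X : Set V) (hX : G.IsTight X)
      (h₁ : X.Nontrivial) (h₂ : Xᶜ.Nontrivial) {K₁ : SimpleGraph W₁} {K₂ : SimpleGraph W₂}
      {f₁ : V → W₁} {f₂ : V → W₂} (c₁ : G.IsContraction X K₁ f₁) (c₂ : G.IsContraction Xᶜ K₂ f₂)
      {n m : ℕ} (hn : HasBrickCount K₁ n) (hm : HasBrickCount K₂ m) : HasBrickCount G (n + m)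

section Basic

variable {G : SimpleGraph V} {K : SimpleGraph W} {f : V → W} {X Y : Set V} {σ : V → V}

lemma IsMatchingInvolution.ne (h : G.IsMatchingInvolution σ) (v : V) : σ v ≠ v :=
  (h.adj v).ne'

lemma IsMatchingCovered.exists_adj_mem (hG : G.IsMatchingCovered) (hX : X.Nonempty)
    (hX' : Xᶜ.Nonempty) : ∃ a ∈ X, ∃ b ∉ X, G.Adj a b := by
  obtain ⟨x, hx⟩ := hX
  obtain ⟨y, hy⟩ := hX'
  obtain ⟨w⟩ := hG.preconnected x y
  obtain ⟨d, -, h₁, h₂⟩ := w.exists_boundary_dart X hx hy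
  exact ⟨_, h₁, _, h₂, d.adj⟩

lemma IsMatchingCovered.exists_involution (hG : G.IsMatchingCovered) :
    ∃ σ, G.IsMatchingInvolution σ := by
  obtain ⟨x, y, hxy⟩ := hG.nontrivial
  obtain ⟨a, -, b, -, hab⟩ := hG.exists_adj_mem (X := {x}) ⟨x, rfl⟩ ⟨y, by simpa using hxy.symm⟩
  obtain ⟨σ, hσ, -⟩ := hG.exists_matching a b hab
  exact ⟨σ, hσ⟩

lemma IsTight.compl (h : G.IsTight X) : G.IsTight Xᶜ where
  nonempty := h.compl_nonempty
  compl_nonempty := by simpa using h.nonempty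
  existsUnique σ hσ := by
    obtain ⟨u, ⟨h₁, h₂⟩, h₃⟩ := h.existsUnique σ hσ
    refine ⟨σ u, ⟨h₂, by simpa [hσ.invol] using h₁⟩, ?_⟩
    rintro v ⟨hv, hv'⟩
    have := h₃ (σ v) ⟨by simpa using hv', by simpa [hσ.invol] using hv⟩
    rw [← this, hσ.invol]

lemma IsQuotient.comp {U : Type} {L : SimpleGraph U} {g : W → U} (hg : K.IsQuotient L g)
    (hf : G.IsQuotient K f) : G.IsQuotient L (g ∘ f) where
  surjective := hg.surjective.comp hf.surjective
  adj_iff c d := by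
    rw [hg.adj_iff]
    refine and_congr_right fun hcd ↦ ⟨?_, ?_⟩
    · rintro ⟨a, b, ha, hb, hab⟩
      obtain ⟨-, a', b', rfl, rfl, h⟩ := (hf.adj_iff _ _).1 hab
      exact ⟨a', b', ha, hb, h⟩
    · rintro ⟨a, b, ha, hb, hab⟩
      refine ⟨f a, f b, ha, hb, (hf.adj_iff _ _).2 ⟨?_, a, b, rfl, rfl, hab⟩⟩
      intro h
      exact hcd (by rw [← ha, ← hb]; exact congrArg g h)

/-- Quotients with the same kernel are isomorphic. -/
lemma IsQuotient.nonempty_iso {W' : Type} {K' : SimpleGraph W'} {f' : V → W'}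
    (h : G.IsQuotient K f) (h' : G.IsQuotient K' f') (hk : ∀ a b, f a = f b ↔ f' a = f' b) :
    Nonempty (K ≃g K') := by
  have hs (c : W) : f (Function.surjInv h.surjective c) = c := Function.surjInv_eq _ c
  have hs' (c : W') : f' (Function.surjInv h'.surjective c) = c := Function.surjInv_eq _ c
  let e : W ≃ W' :=
    { toFun := fun c ↦ f' (Function.surjInv h.surjective c)
      invFun := fun c ↦ f (Function.surjInv h'.surjective c)
      left_inv := fun c ↦ by
        conv_rhs => rw [← hs c]
        rw [hk, hs']
      right_inv := fun c ↦ by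
        conv_rhs => rw [← hs' c]
        rw [← hk, hs] }
  have he (a : V) : e (f a) = f' a := by
    change f' _ = f' a
    rw [← hk, hs]
  refine ⟨⟨e, ?_⟩⟩
  intro c d
  rw [h.adj_iff, h'.adj_iff, e.injective.ne_iff]
  refine and_congr_right fun _ ↦ ?_
  refine exists_congr fun a ↦ exists_congr fun b ↦ ?_
  rw [← he, ← he, e.injective.eq_iff, e.injective.eq_iff]

lemma exists_isContraction (G : SimpleGraph V) (X : Set V) :
    ∃ (W : Type) (K : SimpleGraph W) (f : V → W), G.IsContraction X K f := by
  let s : Setoid V :=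
    { r := fun a b ↦ a = b ∨ (a ∈ X ∧ b ∈ X)
      iseqv := ⟨fun _ ↦ Or.inl rfl, by tauto, by
        rintro a b c (rfl | h) (rfl | h') <;> tauto⟩ }
  refine ⟨Quotient s, ⟨fun c d ↦ c ≠ d ∧ ∃ a b, Quotient.mk s a = c ∧ Quotient.mk s b = d ∧
    G.Adj a b, ?_, ⟨fun c h ↦ h.1 rfl⟩⟩, Quotient.mk s, ⟨⟨Quotient.mk_surjective, fun _ _ ↦ Iff.rfl⟩,
      fun a b ↦ Quotient.eq⟩⟩
  refine ⟨?_⟩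
  rintro c d ⟨h, a, b, ha, hb, hab⟩
  exact ⟨h.symm, b, a, hb, ha, hab.symm⟩

end Basic

section Contraction

variable {G : SimpleGraph V} {K : SimpleGraph W} {f : V → W} {X Y : Set V} {σ : V → V}
  {τ : W → W}

lemma IsContraction.eq_of_notMem (hf : G.IsContraction X K f) {a b : V} (ha : a ∉ X)
    (h : f a = f b) : a = b := by
  rcases (hf.eq_iff a b).1 h with h | h
  · exact h
  · exact absurd h.1 ha

lemma IsContraction.mem_iff (hf : G.IsContraction X K f) {a b : V} (h : f a = f b) :
    a ∈ X ↔ b ∈ X := by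
  rcases (hf.eq_iff a b).1 h with h | h
  · rw [h]
  · simp [h]

/-- Every vertex of a contraction is left by exactly one edge of a perfect matching. -/
lemma IsContraction.existsUnique (hf : G.IsContraction X K f) (hX : G.IsTight X)
    (hσ : G.IsMatchingInvolution σ) (w : W) : ∃! u, f u = w ∧ f (σ u) ≠ w := by
  obtain ⟨v, rfl⟩ := hf.surjective w
  by_cases hv : v ∈ X
  · obtain ⟨u, ⟨h₁, h₂⟩, h₃⟩ := hX.existsUnique σ hσ
    refine ⟨u, ⟨(hf.eq_iff _ _).2 (.inr ⟨h₁, hv⟩), fun h ↦ h₂ ((hf.mem_iff h).2 hv)⟩, ?_⟩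
    rintro u' ⟨h₄, h₅⟩
    exact h₃ u' ⟨(hf.mem_iff h₄).2 hv, fun h ↦ h₅ ((hf.eq_iff _ _).2 (.inr ⟨h, hv⟩))⟩
  · refine ⟨v, ⟨rfl, fun h ↦ hσ.ne v (hf.eq_of_notMem hv h.symm).symm⟩, ?_⟩
    rintro u' ⟨h₄, -⟩
    exact (hf.eq_of_notMem hv h₄.symm).symm

lemma IsContraction.exists_push (hf : G.IsContraction X K f) (hX : G.IsTight X)
    (hσ : G.IsMatchingInvolution σ) :
    ∃ τ, K.IsMatchingInvolution τ ∧ ∀ u, f (σ u) ≠ f u → f (σ u) = τ (f u) := by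
  choose u hu hu' using hf.existsUnique hX hσ
  have key (w : W) : u (f (σ (u w))) = σ (u w) :=
    (hu' _ _ ⟨rfl, by rw [hσ.invol, (hu w).1]; exact (hu w).2.symm⟩).symm
  refine ⟨fun w ↦ f (σ (u w)), ⟨fun w ↦ ?_, fun w ↦ ?_⟩, fun v hv ↦ ?_⟩
  · exact (hf.adj_iff _ _).2 ⟨(hu w).2.symm, u w, _, (hu w).1, rfl, hσ.adj _⟩
  · rw [key, hσ.invol, (hu w).1]
  · change _ = f (σ (u (f v)))
    rw [← hu' (f v) v ⟨rfl, hv⟩]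

lemma IsContraction.exists_lift (hf : G.IsContraction X K f) (hG : G.IsMatchingCovered)
    (hX : G.IsTight X) (hτ : K.IsMatchingInvolution τ) :
    ∃ σ, G.IsMatchingInvolution σ ∧ ∀ u, f (σ u) ≠ f u → f (σ u) = τ (f u) := by
  classical
  obtain ⟨x, hx⟩ := hX.nonempty
  obtain ⟨hne, a, b, ha, hb, hab⟩ := (hf.adj_iff _ _).1 (hτ.adj (f x))
  have haX : a ∈ X := (hf.mem_iff ha).2 hx
  have hbX : b ∉ X := fun h ↦ hne (by rw [← hb]; exact (hf.eq_iff _ _).2 (.inr ⟨hx, h⟩))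
  obtain ⟨ρ, hρ, hρa⟩ := hG.exists_matching a b hab
  have hmem {v : V} (hv : v ∈ X) (hva : v ≠ a) : ρ v ∈ X := by
    by_contra h
    exact hva ((hX.existsUnique ρ hρ).unique ⟨hv, h⟩ ⟨haX, hρa ▸ hbX⟩)
  have hX_iff (v : V) : v ∈ X ↔ f v = f x :=
    ⟨fun h ↦ (hf.eq_iff _ _).2 (.inr ⟨h, hx⟩), fun h ↦ (hf.mem_iff h).2 hx⟩
  set s := Function.surjInv hf.surjective with hs_def
  have hs (c : W) : f (s c) = c := Function.surjInv_eq _ c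
  have hsv {v : V} (hv : v ∉ X) : s (f v) = v := (hf.eq_of_notMem hv (hs _).symm).symm
  set σ : V → V := fun v ↦ if v ∈ X then ρ v else if τ (f v) = f x then a else s (τ (f v))
    with hσ_def
  have σ₁ {v : V} (hv : v ∈ X) : σ v = ρ v := by simp [hσ_def, hv]
  have σ₂ {v : V} (hv : v ∉ X) (h : τ (f v) = f x) : σ v = a := by simp [hσ_def, hv, h]
  have σ₃ {v : V} (hv : v ∉ X) (h : τ (f v) ≠ f x) : σ v = s (τ (f v)) := by
    simp [hσ_def, hv, h]
  have hτb : τ (f b) = f x := by rw [hb, hτ.invol]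
  have eq_b {v : V} (hv : v ∉ X) (h : τ (f v) = f x) : v = b :=
    hf.eq_of_notMem hv (by rw [hb, ← h, hτ.invol])
  have hnot {v : V} (h : τ (f v) ≠ f x) : s (τ (f v)) ∉ X := by
    rwa [hX_iff, hs]
  refine ⟨σ, ⟨fun v ↦ ?_, fun v ↦ ?_⟩, fun v hv ↦ ?_⟩
  · by_cases hvX : v ∈ X
    · rw [σ₁ hvX]; exact hρ.adj v
    by_cases h : τ (f v) = f x
    · rw [σ₂ hvX h, eq_b hvX h]; exact hab.symm
    · rw [σ₃ hvX h]
      obtain ⟨-, a', b', ha', hb', h'⟩ := (hf.adj_iff _ _).1 (hτ.adj (f v))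
      rwa [hf.eq_of_notMem (hnot h) ((hs _).trans hb'.symm), hf.eq_of_notMem hvX ha'.symm]
  · by_cases hvX : v ∈ X
    · rw [σ₁ hvX]
      by_cases hva : v = a
      · subst hva
        rw [hρa, σ₂ hbX hτb]
      · rw [σ₁ (hmem hvX hva), hρ.invol]
    by_cases h : τ (f v) = f x
    · rw [σ₂ hvX h, σ₁ haX, hρa, eq_b hvX h]
    · rw [σ₃ hvX h, σ₃ (hnot h) (by rw [hs, hτ.invol]; rwa [Ne, ← hX_iff]), hs, hτ.invol,
        hsv hvX]
  · by_cases hvX : v ∈ X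
    · rw [σ₁ hvX] at hv ⊢
      by_cases hva : v = a
      · subst hva
        rw [hρa, hb, ha]
      · exact absurd ((hf.eq_iff _ _).2 (.inr ⟨hmem hvX hva, hvX⟩)) hv
    by_cases h : τ (f v) = f x
    · rw [σ₂ hvX h, h, ha]
    · rw [σ₃ hvX h, hs]

lemma IsContraction.isTight (hf : G.IsContraction X K f) (hG : G.IsMatchingCovered)
    (hX : G.IsTight X) {Z : Set W} (hZ : G.IsTight (f ⁻¹' Z)) : K.IsTight Z where
  nonempty := hZ.nonempty.imp' f fun _ h ↦ h
  compl_nonempty := hZ.compl_nonempty.imp' f fun _ h ↦ h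
  existsUnique τ hτ := by
    obtain ⟨σ, hσ, h⟩ := hf.exists_lift hG hX hτ
    obtain ⟨u, ⟨hu₁, hu₂⟩, hu₃⟩ := hZ.existsUnique σ hσ
    have hne {v : V} (h₁ : f v ∈ Z) (h₂ : f (σ v) ∉ Z) : f (σ v) ≠ f v := fun h ↦ h₂ (h ▸ h₁)
    refine ⟨f u, ⟨hu₁, by rw [← h u (hne hu₁ hu₂)]; exact hu₂⟩, ?_⟩
    rintro w ⟨hw₁, hw₂⟩
    obtain ⟨v, ⟨rfl, hv⟩, -⟩ := hf.existsUnique hX hσ w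
    rw [← h v hv] at hw₂
    rw [hu₃ v ⟨hw₁, hw₂⟩]

lemma IsContraction.isMatchingCovered (hf : G.IsContraction X K f) (hG : G.IsMatchingCovered)
    (hX : G.IsTight X) : K.IsMatchingCovered where
  nontrivial := by
    obtain ⟨x, hx⟩ := hX.nonempty
    obtain ⟨y, hy⟩ := hX.compl_nonempty
    exact ⟨f x, f y, fun h ↦ hy ((hf.mem_iff h).1 hx)⟩
  preconnected c d := by
    obtain ⟨a, rfl⟩ := hf.surjective c
    obtain ⟨b, rfl⟩ := hf.surjective d
    obtain ⟨w⟩ := hG.preconnected a b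
    induction w with
    | nil => exact .refl _
    | @cons a b c hab _ ih =>
      refine Reachable.trans ?_ ih
      by_cases h : f a = f b
      · rw [h]
      · exact ((hf.adj_iff _ _).2 ⟨h, a, b, rfl, rfl, hab⟩).reachable
  exists_matching c d hcd := by
    obtain ⟨hne, a, b, rfl, rfl, hab⟩ := (hf.adj_iff _ _).1 hcd
    obtain ⟨σ, hσ, rfl⟩ := hG.exists_matching a b hab
    obtain ⟨τ, hτ, h⟩ := hf.exists_push hX hσ
    exact ⟨τ, hτ, (h a hne.symm).symm⟩

lemma IsContraction.card_lt [Finite V] (hf : G.IsContraction X K f) (hX : X.Nontrivial) :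
    Nat.card W < Nat.card V := by
  by_contra! h
  obtain ⟨x, hx, y, hy, hxy⟩ := hX
  exact hxy ((hf.surjective.bijective_of_nat_card_le h).injective ((hf.eq_iff x y).2 (.inr ⟨hx, hy⟩)))

end Contraction

section Counting

variable {G : SimpleGraph V} {X Y : Set V} {σ : V → V}

/-- The vertices of `Z` whose partner lies outside `Z`. -/
def crossing (σ : V → V) (Z : Set V) : Set V := {u | u ∈ Z ∧ σ u ∉ Z}

lemma ncard_crossing_eq_one_iff {Z : Set V} :
    (crossing σ Z).ncard = 1 ↔ ∃! u, u ∈ Z ∧ σ u ∉ Z := by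
  rw [Set.ncard_eq_one]
  exact Set.singleton_iff_unique_mem

open Classical in
/-- A weight cancelling on matched pairs sums up to its value on the unmatched part. -/
lemma IsMatchingInvolution.sum_eq_sum_filter {R : Type*} [AddCommMonoid R]
    (hσ : G.IsMatchingInvolution σ) (Z : Finset V) (g : V → R) (hg : ∀ v, g v + g (σ v) = 0) :
    ∑ v ∈ Z, g v = ∑ v ∈ Z with σ v ∉ Z, g v := by
  rw [← Finset.sum_filter_add_sum_filter_not Z (fun v ↦ σ v ∈ Z)]
  rw [Finset.sum_involution (fun v _ ↦ σ v), zero_add]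
  · intro v _; exact hg v
  · intro v _ _; exact hσ.ne v
  · intro v hv
    simp only [Finset.mem_filter] at hv ⊢
    rw [hσ.invol]; exact hv.symm
  · intro v _; exact hσ.invol v

lemma IsMatchingInvolution.ncard_crossing_mod_two [Finite V] (hσ : G.IsMatchingInvolution σ)
    (Z : Set V) : (crossing σ Z).ncard % 2 = Z.ncard % 2 := by
  classical
  cases nonempty_fintype V
  have h := hσ.sum_eq_sum_filter Z.toFinset (fun _ ↦ (1 : ZMod 2)) fun _ ↦ by decide
  simp only [Finset.sum_const, nsmul_eq_mul, mul_one] at h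
  have h₁ : (crossing σ Z).ncard = (Z.toFinset.filter fun v ↦ σ v ∉ Z.toFinset).card := by
    rw [Set.ncard_eq_toFinset_card']
    congr 1
    ext v
    rw [Set.mem_toFinset]
    simp [crossing]
  rw [h₁, Set.ncard_eq_toFinset_card' Z]
  exact ((ZMod.natCast_eq_natCast_iff' _ _ 2).1 h).symm

lemma ncard_crossing_inter_add_union [Finite V] (σ : V → V) (X Y : Set V) :
    (crossing σ (X ∩ Y)).ncard + (crossing σ (X ∪ Y)).ncard +
      ({u | u ∈ X \ Y ∧ σ u ∈ Y \ X}.ncard + {u | u ∈ Y \ X ∧ σ u ∈ X \ Y}.ncard) =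
      (crossing σ X).ncard + (crossing σ Y).ncard := by
  classical
  cases nonempty_fintype V
  have h (p : V → Prop) : {u | p u}.ncard = ∑ u, if p u then 1 else 0 := by
    rw [Set.ncard_eq_toFinset_card', Finset.sum_boole]
    simp
  simp only [crossing, h, ← Finset.sum_add_distrib]
  refine Finset.sum_congr rfl fun u _ ↦ ?_
  by_cases h₁ : u ∈ X <;> by_cases h₂ : u ∈ Y <;> by_cases h₃ : σ u ∈ X <;>
    by_cases h₄ : σ u ∈ Y <;> simp [h₁, h₂, h₃, h₄]

lemma IsTight.odd_ncard [Finite V] (hX : G.IsTight X) (hσ : G.IsMatchingInvolution σ) :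
    Odd X.ncard := by
  have h := hσ.ncard_crossing_mod_two X
  rw [ncard_crossing_eq_one_iff.2 (hX.existsUnique σ hσ)] at h
  rw [Nat.odd_iff]; omega

/-- Uncrossing of tight cuts, for a single perfect matching. -/
lemma IsTight.uncross_aux [Finite V] (hX : G.IsTight X) (hY : G.IsTight Y)
    (hodd : Odd (X ∩ Y).ncard) (hσ : G.IsMatchingInvolution σ) :
    (∃! u, u ∈ X ∩ Y ∧ σ u ∉ X ∩ Y) ∧ (∃! u, u ∈ X ∪ Y ∧ σ u ∉ X ∪ Y) ∧
      ∀ u ∈ X \ Y, σ u ∉ Y \ X := by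
  have h₁ := ncard_crossing_inter_add_union σ X Y
  rw [ncard_crossing_eq_one_iff.2 (hX.existsUnique σ hσ),
    ncard_crossing_eq_one_iff.2 (hY.existsUnique σ hσ)] at h₁
  have h₂ := hσ.ncard_crossing_mod_two (X ∩ Y)
  have h₃ := hσ.ncard_crossing_mod_two (X ∪ Y)
  have h₄ := Set.ncard_union_add_ncard_inter X Y
  have h₅ := hX.odd_ncard hσ
  have h₆ := hY.odd_ncard hσ
  rw [Nat.odd_iff] at hodd h₅ h₆
  rw [← ncard_crossing_eq_one_iff, ← ncard_crossing_eq_one_iff]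
  refine ⟨by omega, by omega, fun u hu hu' ↦ ?_⟩
  have h₇ : {u | u ∈ X \ Y ∧ σ u ∈ Y \ X}.ncard = 0 := by omega
  rw [Set.ncard_eq_zero] at h₇
  exact (Set.eq_empty_iff_forall_notMem.1 h₇) u ⟨hu, hu'⟩

lemma IsTight.inter [Finite V] (hX : G.IsTight X) (hY : G.IsTight Y)
    (hodd : Odd (X ∩ Y).ncard) : G.IsTight (X ∩ Y) where
  nonempty := Set.nonempty_of_ncard_ne_zero (by rintro h; simp [h] at hodd)
  compl_nonempty := hX.compl_nonempty.mono (Set.compl_subset_compl.2 Set.inter_subset_left)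
  existsUnique _ hσ := (hX.uncross_aux hY hodd hσ).1

lemma IsTight.union [Finite V] (hG : G.IsMatchingCovered) (hX : G.IsTight X) (hY : G.IsTight Y)
    (hodd : Odd (X ∩ Y).ncard) : G.IsTight (X ∪ Y) where
  nonempty := hX.nonempty.mono Set.subset_union_left
  compl_nonempty := by
    obtain ⟨σ, hσ⟩ := hG.exists_involution
    obtain ⟨u, hu, -⟩ := (hX.uncross_aux hY hodd hσ).2.1
    exact ⟨_, hu.2⟩
  existsUnique _ hσ := (hX.uncross_aux hY hodd hσ).2.1

lemma IsTight.not_adj_of_crossing [Finite V] (hG : G.IsMatchingCovered) (hX : G.IsTight X)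
    (hY : G.IsTight Y) (hodd : Odd (X ∩ Y).ncard) {a b : V} (ha : a ∈ X \ Y) (hb : b ∈ Y \ X) :
    ¬ G.Adj a b := by
  intro hab
  obtain ⟨σ, hσ, rfl⟩ := hG.exists_matching a b hab
  exact (hX.uncross_aux hY hodd hσ).2.2 a ha hb

/-- Tight cut contractions preserve two-colourability. -/
lemma IsContraction.hasBoolColoring [Finite V] {K : SimpleGraph W} {f : V → W}
    (hf : G.IsContraction X K f) (hG : G.IsMatchingCovered) (hX : G.IsTight X)
    (hc : G.HasBoolColoring) : K.HasBoolColoring := by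
  classical
  cases nonempty_fintype V
  obtain ⟨c, hc⟩ := hc
  let g : V → ℤ := fun v ↦ if c v then 1 else -1
  have key {a b : V} (ha : a ∈ X) (hb : b ∉ X) (hab : G.Adj a b) : g a = ∑ v ∈ X.toFinset, g v := by
    obtain ⟨σ, hσ, rfl⟩ := hG.exists_matching a b hab
    rw [hσ.sum_eq_sum_filter X.toFinset g]
    · have : (X.toFinset.filter fun v ↦ σ v ∉ X.toFinset) = {a} := by
        ext v
        simp only [Finset.mem_filter, Set.mem_toFinset, Finset.mem_singleton]
        constructor
        · exact fun h ↦ (hX.existsUnique σ hσ).unique h ⟨ha, hb⟩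
        · rintro rfl; exact ⟨ha, hb⟩
      rw [this, Finset.sum_singleton]
    · intro v
      have := hc _ _ (hσ.adj v)
      by_cases h₁ : c v <;> by_cases h₂ : c (σ v) <;> simp_all [g]
  have key' : ∃ t, ∀ a b, a ∈ X → b ∉ X → G.Adj a b → c a = t := by
    refine ⟨decide (∑ v ∈ X.toFinset, g v = 1), fun a b ha hb hab ↦ ?_⟩
    rw [← key ha hb hab]
    by_cases h : c a <;> simp [g, h]
  obtain ⟨t, ht⟩ := key'
  let s := Function.surjInv hf.surjective
  have hs (w : W) : f (s w) = w := Function.surjInv_eq _ w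
  let k : W → Bool := fun w ↦ if s w ∈ X then t else c (s w)
  have hk₁ {a : V} (ha : a ∈ X) : k (f a) = t := if_pos ((hf.mem_iff (hs (f a))).2 ha)
  have hk₂ {a : V} (ha : a ∉ X) : k (f a) = c a := by
    have := hf.eq_of_notMem ha (hs (f a)).symm
    simp only [k]
    rw [← this, if_neg ha]
  refine ⟨k, fun w w' hw ↦ ?_⟩
  obtain ⟨hne, a, b, rfl, rfl, hab⟩ := (hf.adj_iff _ _).1 hw
  by_cases ha : a ∈ X <;> by_cases hb : b ∈ X
  · exact absurd ((hf.eq_iff a b).2 (.inr ⟨ha, hb⟩)) hne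
  · rw [hk₁ ha, hk₂ hb, ← ht a b ha hb hab]; exact hc _ _ hab
  · rw [hk₂ ha, hk₁ hb, ← ht b a hb ha hab.symm]; exact hc _ _ hab
  · rw [hk₂ ha, hk₂ hb]; exact hc _ _ hab

end Counting

section Iso

variable {G : SimpleGraph V} {G' : SimpleGraph W}

lemma IsMatchingInvolution.iso {σ : V → V} (hσ : G.IsMatchingInvolution σ) (e : G ≃g G') :
    G'.IsMatchingInvolution (e ∘ σ ∘ e.symm) where
  adj w := by
    have := e.map_adj_iff.2 (hσ.adj (e.symm w))
    simpa using this
  invol w := by simp [hσ.invol]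

lemma IsTight.iso {X : Set W} (hX : G'.IsTight X) (e : G ≃g G') : G.IsTight (e ⁻¹' X) where
  nonempty := hX.nonempty.preimage e.surjective
  compl_nonempty := hX.compl_nonempty.preimage e.surjective
  existsUnique σ hσ := by
    obtain ⟨w, hw, hw'⟩ := hX.existsUnique _ (hσ.iso e)
    refine ⟨e.symm w, by simpa using hw, fun u hu ↦ ?_⟩
    rw [← hw' (e u) (by simpa using hu)]
    simp

lemma IsMatchingCovered.iso (hG : G.IsMatchingCovered) (e : G ≃g G') :
    G'.IsMatchingCovered where
  nontrivial := have := hG.nontrivial; e.symm.toEquiv.nontrivial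
  preconnected := e.preconnected_iff.1 hG.preconnected
  exists_matching u v huv := by
    obtain ⟨σ, hσ, h⟩ := hG.exists_matching _ _ (e.symm.map_adj_iff.2 huv)
    exact ⟨_, hσ.iso e, by simp [h]⟩

lemma HasBoolColoring.iso (hG : G.HasBoolColoring) (e : G ≃g G') : G'.HasBoolColoring := by
  obtain ⟨c, hc⟩ := hG
  exact ⟨c ∘ e.symm, fun a b hab ↦ hc _ _ (e.symm.map_adj_iff.2 hab)⟩

lemma NoNontrivialTight.iso (hG : G.NoNontrivialTight) (e : G ≃g G') : G'.NoNontrivialTight :=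
  fun _ hX h ↦ hG _ (hX.iso e) ⟨h.1.preimage e.surjective, h.2.preimage e.surjective⟩

lemma IsContraction.comp_iso {U : Type} {K : SimpleGraph U} {X : Set V} {f : V → U}
    (hf : G.IsContraction X K f) (e : G ≃g G') :
    G'.IsContraction (e.symm ⁻¹' X) K (f ∘ e.symm) where
  surjective := hf.surjective.comp e.symm.surjective
  adj_iff c d := by
    rw [hf.adj_iff]
    refine and_congr_right fun _ ↦ ?_
    rw [e.surjective.exists₂]
    simp [e.map_adj_iff]
  eq_iff a b := by
    simp [hf.eq_iff]

lemma HasBrickCount.iso {n : ℕ} (h : G.HasBrickCount n) (e : G ≃g G') : G'.HasBrickCount n := by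
  cases h with
  | brick _ hG hb ht => exact .brick _ (hG.iso e) (fun h ↦ hb (h.iso e.symm)) (ht.iso e)
  | brace _ hG hb ht => exact .brace _ (hG.iso e) (hb.iso e) (ht.iso e)
  | cut _ _ hX h₁ h₂ c₁ c₂ hn hm =>
    exact .cut _ _ (hX.iso e.symm) (h₁.preimage e.symm.surjective)
      (h₂.preimage e.symm.surjective) (c₁.comp_iso e) (c₂.comp_iso e) hn hm

end Iso

section Uniqueness

variable {G : SimpleGraph V} {K : SimpleGraph W} {f : V → W} {X Y : Set V}

theorem IsMatchingCovered.exists_hasBrickCount :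
    ∀ {V : Type} [Finite V] {G : SimpleGraph V}, G.IsMatchingCovered → ∃ n, G.HasBrickCount n := by
  intro V _ G hG
  induction hN : Nat.card V using Nat.strong_induction_on generalizing V with
  | _ N ih =>
    by_cases ht : G.NoNontrivialTight
    · by_cases hb : G.HasBoolColoring
      · exact ⟨0, .brace G hG hb ht⟩
      · exact ⟨1, .brick G hG hb ht⟩
    · simp only [NoNontrivialTight, not_forall, not_not] at ht
      obtain ⟨X, hX, h₁, h₂⟩ := ht
      obtain ⟨W₁, K₁, f₁, c₁⟩ := G.exists_isContraction X
      obtain ⟨W₂, K₂, f₂, c₂⟩ := G.exists_isContraction Xᶜ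
      have := Finite.of_surjective _ c₁.surjective
      have := Finite.of_surjective _ c₂.surjective
      obtain ⟨n, hn⟩ := ih _ (hN ▸ c₁.card_lt h₁) (c₁.isMatchingCovered hG hX) rfl
      obtain ⟨m, hm⟩ := ih _ (hN ▸ c₂.card_lt h₂) (c₂.isMatchingCovered hG hX.compl) rfl
      exact ⟨n + m, .cut G X hX h₁ h₂ c₁ c₂ hn hm⟩

theorem HasBrickCount.eq_zero_of_hasBoolColoring {n : ℕ} (h : G.HasBrickCount n) [Finite V]
    (hG : G.IsMatchingCovered) (hb : G.HasBoolColoring) : n = 0 := by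
  have hV : Finite V := inferInstance
  revert hV
  induction h with
  | brick _ _ hb' => exact fun _ ↦ absurd hb hb'
  | brace => exact fun _ ↦ rfl
  | cut G X hX h₁ h₂ c₁ c₂ _ _ ih₁ ih₂ =>
    intro _
    rw [ih₁ (c₁.isMatchingCovered hG hX) (c₁.hasBoolColoring hG hX hb)
      (.of_surjective _ c₁.surjective), ih₂ (c₂.isMatchingCovered hG hX.compl)
      (c₂.hasBoolColoring hG hX.compl hb) (.of_surjective _ c₂.surjective)]

/-- The least brick count of a tight cut decomposition. -/
noncomputable def brickNumber (G : SimpleGraph V) : ℕ := sInf {n | G.HasBrickCount n}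

lemma brickNumber_congr {G' : SimpleGraph W} (e : G ≃g G') : G.brickNumber = G'.brickNumber := by
  unfold brickNumber
  congr 1
  ext n
  exact ⟨fun h ↦ h.iso e, fun h ↦ h.iso e.symm⟩

lemma IsQuotient.brickNumber_eq {W' : Type} {K' : SimpleGraph W'} {f' : V → W'}
    (h : G.IsQuotient K f) (h' : G.IsQuotient K' f') (hk : ∀ a b, f a = f b ↔ f' a = f' b) :
    K.brickNumber = K'.brickNumber := by
  obtain ⟨e⟩ := h.nonempty_iso h' hk
  exact brickNumber_congr e

/-- The brick number of the contraction of `X`. -/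
noncomputable def contractionNumber (G : SimpleGraph V) (X : Set V) : ℕ :=
  (G.exists_isContraction X).choose_spec.choose.brickNumber

lemma IsContraction.brickNumber_eq (hf : G.IsContraction X K f) :
    K.brickNumber = G.contractionNumber X := by
  obtain ⟨f', hf'⟩ := (G.exists_isContraction X).choose_spec.choose_spec
  exact hf.toIsQuotient.brickNumber_eq hf'.toIsQuotient fun a b ↦ by rw [hf.eq_iff, hf'.eq_iff]

/-- The total brick number of the two contractions of a cut. -/
noncomputable def cutNumber (G : SimpleGraph V) (X : Set V) : ℕ :=
  G.contractionNumber X + G.contractionNumber Xᶜ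

lemma cutNumber_compl (G : SimpleGraph V) (X : Set V) : G.cutNumber Xᶜ = G.cutNumber X := by
  rw [cutNumber, cutNumber, compl_compl, add_comm]

/-- Brick counts are unique for matching covered graphs on fewer than `N` vertices. -/
def UniqueBrickCountBelow (N : ℕ) : Prop :=
  ∀ (V : Type) [Finite V] (G : SimpleGraph V), Nat.card V < N → G.IsMatchingCovered →
    ∀ n m, G.HasBrickCount n → G.HasBrickCount m → n = m

lemma UniqueBrickCountBelow.eq_brickNumber {N n : ℕ} (hN : UniqueBrickCountBelow N) [Finite V]
    (hV : Nat.card V < N) (hG : G.IsMatchingCovered) (h : G.HasBrickCount n) :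
    n = G.brickNumber :=
  hN V G hV hG _ _ h (Nat.sInf_mem (s := {n | G.HasBrickCount n}) ⟨n, h⟩)

lemma UniqueBrickCountBelow.hasBrickCount {N : ℕ} (hN : UniqueBrickCountBelow N) [Finite V]
    (hV : Nat.card V < N) (hG : G.IsMatchingCovered) : G.HasBrickCount G.brickNumber := by
  obtain ⟨n, hn⟩ := hG.exists_hasBrickCount
  rwa [← hN.eq_brickNumber hV hG hn]

lemma UniqueBrickCountBelow.brickNumber_eq_cutNumber {N : ℕ} (hN : UniqueBrickCountBelow N)
    [Finite V] (hV : Nat.card V < N) (hG : G.IsMatchingCovered) (hX : G.IsTight X)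
    (h₁ : X.Nontrivial) (h₂ : Xᶜ.Nontrivial) : G.brickNumber = G.cutNumber X := by
  obtain ⟨W₁, K₁, f₁, c₁⟩ := G.exists_isContraction X
  obtain ⟨W₂, K₂, f₂, c₂⟩ := G.exists_isContraction Xᶜ
  have := Finite.of_surjective _ c₁.surjective
  have := Finite.of_surjective _ c₂.surjective
  rw [cutNumber, ← c₁.brickNumber_eq, ← c₂.brickNumber_eq]
  refine (hN.eq_brickNumber hV hG (.cut G X hX h₁ h₂ c₁ c₂ ?_ ?_)).symm
  · exact hN.hasBrickCount ((c₁.card_lt h₁).trans hV) (c₁.isMatchingCovered hG hX)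
  · exact hN.hasBrickCount ((c₂.card_lt h₂).trans hV) (c₂.isMatchingCovered hG hX.compl)

lemma IsContraction.comp {U : Type} {L : SimpleGraph U} {g : W → U} {Z : Set W}
    (hf : G.IsContraction X K f) (hg : K.IsContraction Z L g) (hX : X ⊆ f ⁻¹' Z) :
    G.IsContraction (f ⁻¹' Z) L (g ∘ f) where
  toIsQuotient := hg.toIsQuotient.comp hf.toIsQuotient
  eq_iff a b := by
    simp only [Function.comp, hg.eq_iff, hf.eq_iff, Set.mem_preimage]
    constructor
    · rintro ((h | h) | h)
      · exact .inl h
      · exact .inr ⟨hX h.1, hX h.2⟩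
      · exact .inr h
    · tauto

lemma IsContraction.preimage_image (hf : G.IsContraction X K f) (h : X ⊆ Y) :
    f ⁻¹' (f '' Y) = Y := by
  refine (Set.subset_preimage_image f Y).antisymm' ?_
  rintro a ⟨b, hb, hab⟩
  rcases (hf.eq_iff b a).1 hab with rfl | h'
  · exact hb
  · exact h h'.2

/-- Contracting `X` and then cutting along a larger tight set `Y`. -/
lemma UniqueBrickCountBelow.contractionNumber_eq_add {N : ℕ} (hN : UniqueBrickCountBelow N)
    [Finite V] (hV : Nat.card V ≤ N) (hG : G.IsMatchingCovered) (hX : G.IsTight X)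
    (hY : G.IsTight Y) (hXY : X ⊂ Y) (h₁ : X.Nontrivial) (h₂ : Yᶜ.Nontrivial) :
    ∃ (U : Type) (L : SimpleGraph U) (g : V → U), G.IsQuotient L g ∧
      (∀ a b, g a = g b ↔ a = b ∨ (a ∈ X ∧ b ∈ X) ∨ (a ∈ Yᶜ ∧ b ∈ Yᶜ)) ∧
      G.contractionNumber X = G.contractionNumber Y + L.brickNumber := by
  obtain ⟨W, K, f, hf⟩ := G.exists_isContraction X
  have := Finite.of_surjective _ hf.surjective
  have hZ := hf.preimage_image hXY.subset
  set Z := f '' Y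
  obtain ⟨W₁, K₁, f₁, c₁⟩ := K.exists_isContraction Z
  obtain ⟨W₂, K₂, f₂, c₂⟩ := K.exists_isContraction Zᶜ
  have hZt : K.IsTight Z := hf.isTight hG hX (by rwa [hZ])
  have hmem (a : V) : f a ∈ Z ↔ a ∈ Y := by rw [← Set.mem_preimage, hZ]
  have hZ₁ : Z.Nontrivial := by
    obtain ⟨x, hx⟩ := hX.nonempty
    obtain ⟨y, hy, hy'⟩ := Set.exists_of_ssubset hXY
    exact ⟨f x, (hmem x).2 (hXY.subset hx), f y, (hmem y).2 hy,
      fun h ↦ hy' ((hf.mem_iff h).1 hx)⟩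
  have hZ₂ : Zᶜ.Nontrivial := by
    obtain ⟨a, ha, b, hb, hab⟩ := h₂
    exact ⟨f a, fun h ↦ ha ((hmem a).1 h), f b, fun h ↦ hb ((hmem b).1 h),
      fun h ↦ hab (hf.eq_of_notMem (fun h' ↦ ha (hXY.subset h')) h)⟩
  refine ⟨W₂, K₂, f₂ ∘ f, c₂.toIsQuotient.comp hf.toIsQuotient, fun a b ↦ ?_, ?_⟩
  · simp only [Function.comp, c₂.eq_iff, hf.eq_iff, Set.mem_compl_iff, hmem, or_assoc]
  · have h := hN.brickNumber_eq_cutNumber ((hf.card_lt h₁).trans_le hV)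
      (hf.isMatchingCovered hG hX) hZt hZ₁ hZ₂
    rw [cutNumber, ← c₂.brickNumber_eq, ← c₁.brickNumber_eq, hf.brickNumber_eq] at h
    rw [h, (hf.comp c₁ (hZ.symm ▸ hXY.subset)).brickNumber_eq, hZ]

lemma UniqueBrickCountBelow.cutNumber_eq_of_ssubset {N : ℕ} (hN : UniqueBrickCountBelow N)
    [Finite V] (hV : Nat.card V ≤ N) (hG : G.IsMatchingCovered) (hX : G.IsTight X)
    (hY : G.IsTight Y) (hXY : X ⊂ Y) (h₁ : X.Nontrivial) (h₂ : Yᶜ.Nontrivial) :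
    G.cutNumber X = G.cutNumber Y := by
  obtain ⟨U, L, g, hg, hgk, hg'⟩ := hN.contractionNumber_eq_add hV hG hX hY hXY h₁ h₂
  obtain ⟨U', L', g', hh, hhk, hh'⟩ := hN.contractionNumber_eq_add hV hG hY.compl hX.compl
    (compl_lt_compl_iff_lt.2 hXY) h₂ (by rwa [compl_compl])
  have : L.brickNumber = L'.brickNumber := hg.brickNumber_eq hh fun a b ↦ by
    rw [hgk, hhk, compl_compl]; tauto
  rw [cutNumber, cutNumber, hg', hh', this]
  ring

/-- In a maximally crossing pair of tight cuts, the vertex outside the union has a neighbour in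
either set. -/
lemma IsTight.exists_adj_of_crossing (hG : G.IsMatchingCovered) (hX : G.IsTight X) {x y : V}
    (hx : X ∩ Y = {x}) (hy : (X ∪ Y)ᶜ = {y}) (hne : (X \ Y).Nonempty)
    (hnot : ∀ a ∈ X \ Y, ∀ b ∈ Y \ X, ¬ G.Adj a b) : ∃ b ∈ X, G.Adj y b := by
  have hx' : x ∈ X ∩ Y := hx ▸ rfl
  have hout {a b : V} (ha : a ∈ X \ Y) (hb : b ∉ X) (hab : G.Adj a b) : b = y := by
    have : b ∈ (X ∪ Y)ᶜ := fun h ↦ h.elim hb fun h ↦ hnot a ha b ⟨h, hb⟩ hab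
    rwa [hy] at this
  obtain ⟨a, ha, b, hb, hab⟩ := hG.exists_adj_mem hne ⟨x, fun h ↦ h.2 hx'.2⟩
  by_cases hbX : b ∈ X
  · have hbx : b = x := by
      have : b ∈ X ∩ Y := ⟨hbX, by by_contra h; exact hb ⟨hbX, h⟩⟩
      rwa [hx] at this
    subst hbx
    obtain ⟨σ, hσ, rfl⟩ := hG.exists_matching a b hab
    obtain ⟨u, ⟨hu, hu'⟩, -⟩ := hX.existsUnique σ hσ
    have huY : u ∉ Y := by
      intro h
      have : u ∈ X ∩ Y := ⟨hu, h⟩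
      rw [hx] at this
      rw [this, hσ.invol] at hu'
      exact hu' ha.1
    have := hout ⟨hu, huY⟩ hu' (hσ.adj u)
    exact ⟨u, hu, this ▸ (hσ.adj u).symm⟩
  · obtain rfl := hout ha hbX hab
    exact ⟨a, ha.1, hab.symm⟩

/-- In a maximally crossing pair of tight cuts, contracting one set and contracting the complement
of the other one give isomorphic graphs. -/
lemma IsTight.contractionNumber_eq_of_crossing (hG : G.IsMatchingCovered)
    (hX : G.IsTight X) (hY : G.IsTight Y) {x y : V} (hx : X ∩ Y = {x}) (hy : (X ∪ Y)ᶜ = {y})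
    (hne : (X \ Y).Nonempty) (hnot : ∀ a ∈ X \ Y, ∀ b ∈ Y \ X, ¬ G.Adj a b) :
    G.contractionNumber X = G.contractionNumber Yᶜ := by
  classical
  obtain ⟨W, K, f, hf⟩ := G.exists_isContraction X
  obtain ⟨W', K', f', hf'⟩ := G.exists_isContraction Yᶜ
  have hx' : x ∈ X ∩ Y := hx ▸ rfl
  have hy' : y ∈ (X ∪ Y)ᶜ := hy ▸ rfl
  have hyX : y ∉ X := fun h ↦ hy' (.inl h)
  have hyY : y ∉ Y := fun h ↦ hy' (.inr h)
  have eq_x {a : V} (h₁ : a ∈ X) (h₂ : a ∈ Y) : a = x := by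
    have : a ∈ X ∩ Y := ⟨h₁, h₂⟩
    rwa [hx] at this
  have eq_y {a : V} (h₁ : a ∉ X) (h₂ : a ∉ Y) : a = y := by
    have : a ∈ (X ∪ Y)ᶜ := fun h ↦ h.elim h₁ h₂
    rwa [hy] at this
  let t : V → W' := fun a ↦ if a ∈ X then f' x else f' a
  have t₁ {a : V} (ha : a ∈ X) : t a = f' x := if_pos ha
  have t₂ {a : V} (ha : a ∉ X) : t a = f' a := if_neg ha
  have t₃ {a : V} (ha : a ∈ Y) : t a = f' a := by
    by_cases h : a ∈ X
    · rw [t₁ h, eq_x h ha]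
    · exact t₂ h
  have f'y {a : V} (ha : a ∉ Y) : f' a = f' y := (hf'.eq_iff _ _).2 (.inr ⟨ha, hyY⟩)
  obtain ⟨b₀, hb₀, hyb₀⟩ := hX.exists_adj_of_crossing hG hx hy hne hnot
  obtain ⟨b₁, hb₁, hxb₁⟩ : ∃ b ∈ Yᶜ, G.Adj x b := by
    refine hY.compl.exists_adj_of_crossing (Y := Xᶜ) hG (x := y) ?_ ?_ ?_ ?_
    · rw [← hy, Set.compl_union, Set.inter_comm]
    · rw [← hx, Set.compl_union, compl_compl, compl_compl, Set.inter_comm]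
    · rwa [compl_sdiff_compl]
    · rwa [compl_sdiff_compl, compl_sdiff_compl]
  have ht : G.IsQuotient K' t := by
    refine ⟨fun c ↦ ?_, fun c d ↦ ?_⟩
    · obtain ⟨a, rfl⟩ := hf'.surjective c
      by_cases ha : a ∈ Y
      · exact ⟨a, t₃ ha⟩
      · exact ⟨y, by rw [t₂ hyX, f'y ha]⟩
    rw [hf'.adj_iff]
    refine and_congr_right fun hcd ↦ ⟨?_, ?_⟩
    · rintro ⟨a, b, rfl, rfl, hab⟩
      by_cases ha : a ∈ Y <;> by_cases hb : b ∈ Y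
      · exact ⟨a, b, t₃ ha, t₃ hb, hab⟩
      · by_cases hbX : b ∈ X
        · have haX : a ∈ X := by
            by_contra h; exact hnot b ⟨hbX, hb⟩ a ⟨ha, h⟩ hab.symm
          rw [eq_x haX ha, f'y hb]
          exact ⟨b₀, y, t₁ hb₀, t₂ hyX, hyb₀.symm⟩
        · exact ⟨a, b, t₃ ha, t₂ hbX, hab⟩
      · by_cases haX : a ∈ X
        · have hbX : b ∈ X := by
            by_contra h; exact hnot a ⟨haX, ha⟩ b ⟨hb, h⟩ hab
          rw [eq_x hbX hb, f'y ha]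
          exact ⟨y, b₀, t₂ hyX, t₁ hb₀, hyb₀⟩
        · exact ⟨a, b, t₂ haX, t₃ hb, hab⟩
      · exact absurd ((f'y ha).trans (f'y hb).symm) hcd
    · rintro ⟨a, b, rfl, rfl, hab⟩
      by_cases ha : a ∈ X <;> by_cases hb : b ∈ X
      · exact absurd ((t₁ ha).trans (t₁ hb).symm) hcd
      · by_cases hbY : b ∈ Y
        · have haY : a ∈ Y := by
            by_contra h; exact hnot a ⟨ha, h⟩ b ⟨hbY, hb⟩ hab
          exact ⟨a, b, (t₃ haY).symm, (t₃ hbY).symm, hab⟩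
        · rw [t₁ ha, eq_y hb hbY, t₂ hyX]
          exact ⟨x, b₁, rfl, f'y hb₁, hxb₁⟩
      · by_cases haY : a ∈ Y
        · have hbY : b ∈ Y := by
            by_contra h; exact hnot b ⟨hb, h⟩ a ⟨haY, ha⟩ hab.symm
          exact ⟨a, b, (t₃ haY).symm, (t₃ hbY).symm, hab⟩
        · rw [t₁ hb, eq_y ha haY, t₂ hyX]
          exact ⟨b₁, x, f'y hb₁, rfl, hxb₁.symm⟩
      · exact ⟨a, b, (t₂ ha).symm, (t₂ hb).symm, hab⟩
  have hx_ne {a : V} (ha : a ∉ X) : f' x ≠ f' a := fun h ↦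
    ha (hf'.eq_of_notMem (by simpa using hx'.2) h ▸ hx'.1)
  rw [← hf.brickNumber_eq, ← hf'.brickNumber_eq]
  refine hf.toIsQuotient.brickNumber_eq ht fun a b ↦ ?_
  rw [hf.eq_iff]
  by_cases ha : a ∈ X <;> by_cases hb : b ∈ X
  · simp [ha, hb, t₁]
  · simp only [ha, hb, t₁ ha, t₂ hb, hx_ne hb, iff_false]
    rintro (rfl | h)
    · exact hb ha
    · exact h.2
  · simp only [ha, hb, t₂ ha, t₁ hb, (hx_ne ha).symm, iff_false]
    rintro (rfl | h)
    · exact ha hb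
    · exact h.1
  · rw [t₂ ha, t₂ hb, hf'.eq_iff]
    exact ⟨fun h ↦ .inl (h.resolve_right fun h ↦ ha h.1), fun h ↦ .inl (h.elim id fun h ↦
      (eq_y ha h.1).trans (eq_y hb h.2).symm)⟩

lemma UniqueBrickCountBelow.cutNumber_eq_of_odd {N : ℕ} (hN : UniqueBrickCountBelow N)
    [Finite V] (hV : Nat.card V ≤ N) (hG : G.IsMatchingCovered) (hX : G.IsTight X)
    (hY : G.IsTight Y) (hX₁ : X.Nontrivial) (hX₂ : Xᶜ.Nontrivial) (hY₁ : Y.Nontrivial)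
    (hY₂ : Yᶜ.Nontrivial) (hodd : Odd (X ∩ Y).ncard) : G.cutNumber X = G.cutNumber Y := by
  by_cases hXY : X ⊆ Y
  · rcases hXY.eq_or_ssubset with rfl | h
    · rfl
    · exact hN.cutNumber_eq_of_ssubset hV hG hX hY h hX₁ hY₂
  by_cases hYX : Y ⊆ X
  · rcases hYX.eq_or_ssubset with rfl | h
    · rfl
    · exact (hN.cutNumber_eq_of_ssubset hV hG hY hX h hY₁ hX₂).symm
  have hI := hX.inter hY hodd
  have hU := hX.union hG hY hodd
  by_cases hI₁ : (X ∩ Y).Nontrivial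
  · have h₁ : X ∩ Y ⊂ X := Set.inter_subset_left.ssubset_of_not_subset fun h ↦
      hXY (h.trans Set.inter_subset_right)
    have h₂ : X ∩ Y ⊂ Y := Set.inter_subset_right.ssubset_of_not_subset fun h ↦
      hYX (h.trans Set.inter_subset_left)
    rw [← hN.cutNumber_eq_of_ssubset hV hG hI hX h₁ hI₁ hX₂,
      hN.cutNumber_eq_of_ssubset hV hG hI hY h₂ hI₁ hY₂]
  by_cases hU₁ : (X ∪ Y)ᶜ.Nontrivial
  · have h₁ : X ⊂ X ∪ Y := Set.subset_union_left.ssubset_of_not_subset fun h ↦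
      hYX (Set.subset_union_right.trans h)
    have h₂ : Y ⊂ X ∪ Y := Set.subset_union_right.ssubset_of_not_subset fun h ↦
      hXY (Set.subset_union_left.trans h)
    rw [hN.cutNumber_eq_of_ssubset hV hG hX hU h₁ hX₁ hU₁,
      hN.cutNumber_eq_of_ssubset hV hG hY hU h₂ hY₁ hU₁]
  obtain ⟨x, hx⟩ := Set.exists_eq_singleton_iff_nonempty_subsingleton.2
    ⟨hI.nonempty, Set.not_nontrivial_iff.1 hI₁⟩
  obtain ⟨y, hy⟩ := Set.exists_eq_singleton_iff_nonempty_subsingleton.2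
    ⟨hU.compl_nonempty, Set.not_nontrivial_iff.1 hU₁⟩
  have hnot {a b : V} (ha : a ∈ X \ Y) (hb : b ∈ Y \ X) : ¬ G.Adj a b :=
    hX.not_adj_of_crossing hG hY hodd ha hb
  have h₁ := hX.contractionNumber_eq_of_crossing hG hY hx hy (Set.sdiff_nonempty.2 hXY)
    fun a ha b hb ↦ hnot ha hb
  have h₂ := hY.contractionNumber_eq_of_crossing hG hX (by rwa [Set.inter_comm])
    (by rwa [Set.union_comm]) (Set.sdiff_nonempty.2 hYX) fun a ha b hb h ↦ hnot hb ha h.symm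
  rw [cutNumber, cutNumber, h₁, h₂, add_comm]

lemma UniqueBrickCountBelow.cutNumber_eq {N : ℕ} (hN : UniqueBrickCountBelow N)
    [Finite V] (hV : Nat.card V ≤ N) (hG : G.IsMatchingCovered) (hX : G.IsTight X)
    (hY : G.IsTight Y) (hX₁ : X.Nontrivial) (hX₂ : Xᶜ.Nontrivial) (hY₁ : Y.Nontrivial)
    (hY₂ : Yᶜ.Nontrivial) : G.cutNumber X = G.cutNumber Y := by
  by_cases hodd : Odd (X ∩ Y).ncard
  · exact hN.cutNumber_eq_of_odd hV hG hX hY hX₁ hX₂ hY₁ hY₂ hodd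
  · rw [← G.cutNumber_compl Y]
    refine hN.cutNumber_eq_of_odd hV hG hX hY.compl hX₁ hX₂ hY₂ (by rwa [compl_compl]) ?_
    obtain ⟨σ, hσ⟩ := hG.exists_involution
    have h₁ := hX.odd_ncard hσ
    have h₂ := Set.ncard_inter_add_ncard_sdiff_eq_ncard X Y
    rw [← Set.sdiff_eq]
    rw [Nat.odd_iff] at *
    omega

lemma uniqueBrickCountBelow (N : ℕ) : UniqueBrickCountBelow N := by
  induction N with
  | zero => intro V _ G h; omega
  | succ N hN =>
    intro V _ G hV hG n m hn hm
    have hV' : Nat.card V ≤ N := by omega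
    have key {W₁ W₂ : Type} {X : Set V} {K₁ : SimpleGraph W₁} {K₂ : SimpleGraph W₂}
        {f₁ : V → W₁} {f₂ : V → W₂} (hX : G.IsTight X) (h₁ : X.Nontrivial) (h₂ : Xᶜ.Nontrivial)
        (c₁ : G.IsContraction X K₁ f₁) (c₂ : G.IsContraction Xᶜ K₂ f₂) {n m : ℕ}
        (hn : HasBrickCount K₁ n) (hm : HasBrickCount K₂ m) : n + m = G.cutNumber X := by
      have := Finite.of_surjective _ c₁.surjective
      have := Finite.of_surjective _ c₂.surjective
      rw [cutNumber, ← c₁.brickNumber_eq, ← c₂.brickNumber_eq,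
        hN.eq_brickNumber ((c₁.card_lt h₁).trans_le hV') (c₁.isMatchingCovered hG hX) hn,
        hN.eq_brickNumber ((c₂.card_lt h₂).trans_le hV') (c₂.isMatchingCovered hG hX.compl) hm]
    cases hn with
    | brick _ _ hb ht =>
      cases hm with
      | brick => rfl
      | brace _ _ hb' => exact absurd hb' hb
      | cut _ X hX h₁ h₂ => exact absurd ⟨h₁, h₂⟩ (ht X hX)
    | brace _ _ hb ht =>
      cases hm with
      | brick _ _ hb' => exact absurd hb hb'
      | brace => rfl
      | cut _ X hX h₁ h₂ => exact absurd ⟨h₁, h₂⟩ (ht X hX)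
    | cut _ X hX h₁ h₂ c₁ c₂ hn₁ hn₂ =>
      cases hm with
      | brick _ _ _ ht => exact absurd ⟨h₁, h₂⟩ (ht X hX)
      | brace _ _ _ ht => exact absurd ⟨h₁, h₂⟩ (ht X hX)
      | cut _ Y hY h₃ h₄ c₃ c₄ hm₁ hm₂ =>
        rw [key hX h₁ h₂ c₁ c₂ hn₁ hn₂, key hY h₃ h₄ c₃ c₄ hm₁ hm₂]
        exact hN.cutNumber_eq hV' hG hX hY h₁ h₂ h₃ h₄

/-- **Lovász's theorem** on the number of bricks: all tight cut decompositions of a matching covered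
graph have the same number of bricks. -/
theorem HasBrickCount.unique [Finite V] (hG : G.IsMatchingCovered) {n m : ℕ}
    (hn : G.HasBrickCount n) (hm : G.HasBrickCount m) : n = m :=
  uniqueBrickCountBelow _ V G (Nat.lt_succ_self _) hG n m hn hm

end Uniqueness

end SimpleGraph

namespace Multigraph

variable {G : Multigraph}

/-- The simple graph underlying a multigraph. -/
def toSimpleGraph (G : Multigraph) : SimpleGraph G.V where
  Adj := G.Adj
  symm := ⟨fun u v ⟨h, e, he⟩ ↦ ⟨h.symm, e, by rw [he, Sym2.eq_swap]⟩⟩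
  loopless := ⟨fun _ h ↦ h.1 rfl⟩

lemma ne_of_ends_eq {e : G.E} {a b : G.V} (h : G.ends e = s(a, b)) : a ≠ b := by
  have := G.no_loops e
  rwa [h, Sym2.mk_isDiag_iff] at this

lemma toSimpleGraph_adj_iff {a b : G.V} : G.toSimpleGraph.Adj a b ↔ ∃ e, G.ends e = s(a, b) :=
  ⟨fun h ↦ h.2, fun h ↦ ⟨ne_of_ends_eq h.choose_spec, h⟩⟩

lemma IsPerfectMatching.exists_involution {M : Set G.E} (hM : G.IsPerfectMatching M) :
    ∃ σ, G.toSimpleGraph.IsMatchingInvolution σ ∧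
      ∀ v, ∀ e ∈ M, G.Inc v e → G.ends e = s(v, σ v) := by
  choose ε hε hε' using hM
  have h (v : G.V) : ∃ w, G.ends (ε v) = s(v, w) := by
    obtain ⟨w, hw⟩ := (hε v).2
    exact ⟨w, hw⟩
  choose σ hσ using h
  have hεσ (v : G.V) : ε v = ε (σ v) := by
    refine hε' _ _ ⟨(hε v).1, ?_⟩
    rw [Inc, hσ]
    exact Sym2.mem_mk_right _ _
  refine ⟨σ, ⟨fun v ↦ toSimpleGraph_adj_iff.2 ⟨_, hσ v⟩, fun v ↦ ?_⟩, fun v e he hv ↦ ?_⟩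
  · have h₁ := hσ (σ v)
    rw [← hεσ, hσ, Sym2.eq_swap] at h₁
    exact (Sym2.congr_right.1 h₁).symm
  · rw [hε' v e ⟨he, hv⟩, hσ]

lemma exists_isPerfectMatching {σ : G.V → G.V} (hσ : G.toSimpleGraph.IsMatchingInvolution σ) :
    ∃ M, G.IsPerfectMatching M ∧ ∀ v, ∀ e ∈ M, G.Inc v e → G.ends e = s(v, σ v) := by
  have h (z : Sym2 G.V) : ∃ e, (∃ v, z = s(v, σ v)) → G.ends e = z := by
    by_cases hz : ∃ v, z = s(v, σ v)
    · obtain ⟨v, rfl⟩ := hz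
      obtain ⟨e, he⟩ := toSimpleGraph_adj_iff.1 (hσ.adj v)
      exact ⟨e, fun _ ↦ he⟩
    · obtain ⟨a, b, rfl⟩ := Multigraph.Sym2.exists_eq_mk z
      obtain ⟨e, -⟩ := toSimpleGraph_adj_iff.1 (hσ.adj a)
      exact ⟨e, fun h ↦ absurd h hz⟩
  choose ε hε using h
  have hε' (v : G.V) : G.ends (ε s(v, σ v)) = s(v, σ v) := hε _ ⟨v, rfl⟩
  have key (v w : G.V) (h : G.Inc v (ε s(w, σ w))) : s(w, σ w) = s(v, σ v) := by
    rw [Inc, hε', Sym2.mem_iff] at h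
    rcases h with rfl | rfl
    · rfl
    · rw [hσ.invol, Sym2.eq_swap]
  refine ⟨Set.range fun v ↦ ε s(v, σ v), fun v ↦ ⟨ε s(v, σ v), ⟨⟨v, rfl⟩, ?_⟩, ?_⟩, ?_⟩
  · rw [Inc, hε']
    exact Sym2.mem_mk_left _ _
  · rintro _ ⟨⟨w, rfl⟩, hw⟩
    exact congrArg ε (key v w hw)
  · rintro v _ ⟨w, rfl⟩ hw
    exact (hε' w).trans (key v w hw)

lemma existsUnique_mem_cut_iff {M : Set G.E} (hM : G.IsPerfectMatching M) {σ : G.V → G.V}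
    (hσ : ∀ v, ∀ e ∈ M, G.Inc v e → G.ends e = s(v, σ v)) (X : Set G.V) :
    (∃! e, e ∈ M ∧ e ∈ G.cut X) ↔ ∃! u, u ∈ X ∧ σ u ∉ X := by
  have h₁ {e : G.E} (he : e ∈ M) (heX : e ∈ G.cut X) :
      ∃ u, (u ∈ X ∧ σ u ∉ X) ∧ G.ends e = s(u, σ u) := by
    obtain ⟨u, hu, w, hw, h⟩ := heX
    have h' := hσ u e he (by rw [Inc, h]; exact Sym2.mem_mk_left _ _)
    have hw' : w = σ u := Sym2.congr_right.1 (h.symm.trans h')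
    exact ⟨u, ⟨hu, hw' ▸ hw⟩, h'⟩
  have h₂ {u : G.V} (hu : u ∈ X) (hu' : σ u ∉ X) :
      ∃ e, (e ∈ M ∧ e ∈ G.cut X) ∧ G.ends e = s(u, σ u) := by
    obtain ⟨e, ⟨he, hue⟩, -⟩ := hM u
    exact ⟨e, ⟨he, u, hu, σ u, hu', hσ u e he hue⟩, hσ u e he hue⟩
  constructor
  · rintro ⟨e, ⟨he, heX⟩, huniq⟩
    obtain ⟨u, hu, heu⟩ := h₁ he heX
    refine ⟨u, hu, fun v hv ↦ ?_⟩
    obtain ⟨e', he', hev⟩ := h₂ hv.1 hv.2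
    rw [huniq e' he', heu, Sym2.eq_iff] at hev
    rcases hev with h | h
    · exact h.1.symm
    · exact absurd (h.1 ▸ hu.1) hv.2
  · rintro ⟨u, hu, huniq⟩
    obtain ⟨e, he, heu⟩ := h₂ hu.1 hu.2
    refine ⟨e, he, fun e' he' ↦ ?_⟩
    obtain ⟨v, hv, hev⟩ := h₁ he'.1 he'.2
    rw [huniq v hv] at hev
    refine (hM u).unique ⟨he'.1, ?_⟩ ⟨he.1, ?_⟩
    · rw [Inc, hev]; exact Sym2.mem_mk_left _ _
    · rw [Inc, heu]; exact Sym2.mem_mk_left _ _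

lemma isTight_toSimpleGraph_iff {X : Set G.V} : G.toSimpleGraph.IsTight X ↔ G.IsTightCut X := by
  constructor
  · rintro ⟨h₁, h₂, h₃⟩
    refine ⟨h₁, h₂, fun M hM ↦ ?_⟩
    obtain ⟨σ, hσ, h⟩ := hM.exists_involution
    exact (existsUnique_mem_cut_iff hM h X).2 (h₃ σ hσ)
  · rintro ⟨h₁, h₂, h₃⟩
    refine ⟨h₁, h₂, fun σ hσ ↦ ?_⟩
    obtain ⟨M, hM, h⟩ := exists_isPerfectMatching hσ
    exact (existsUnique_mem_cut_iff hM h X).1 (h₃ M hM)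

lemma MatchingCovered.toSimpleGraph (hG : G.MatchingCovered) :
    G.toSimpleGraph.IsMatchingCovered where
  nontrivial := Finite.one_lt_card_iff_nontrivial.1 hG.1
  preconnected u v := SimpleGraph.reachable_iff_reflTransGen _ _ |>.2 (hG.2.1.2 u v)
  exists_matching u v huv := by
    obtain ⟨e, he⟩ := toSimpleGraph_adj_iff.1 huv
    obtain ⟨M, hM, heM⟩ := hG.2.2 e
    obtain ⟨σ, hσ, h⟩ := hM.exists_involution
    refine ⟨σ, hσ, ?_⟩
    have := h u e heM (by rw [Inc, he]; exact Sym2.mem_mk_left _ _)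
    rw [he] at this
    exact (Sym2.congr_right.1 this).symm

lemma hasBoolColoring_toSimpleGraph_iff : G.toSimpleGraph.HasBoolColoring ↔ G.Bipartite := by
  refine exists_congr fun c ↦ ⟨fun h e a b he ↦ h a b (toSimpleGraph_adj_iff.2 ⟨e, he⟩), ?_⟩
  intro h a b hab
  obtain ⟨e, he⟩ := toSimpleGraph_adj_iff.1 hab
  exact h e a b he

lemma not_trivialShore_iff {X : Set G.V} (h₁ : X.Nonempty) (h₂ : Xᶜ.Nonempty) :
    ¬ G.TrivialShore X ↔ X.Nontrivial ∧ Xᶜ.Nontrivial := by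
  rw [TrivialShore, not_or]
  refine and_congr ?_ ?_
  · rw [← Set.not_subsingleton_iff, not_iff_not, Set.exists_eq_singleton_iff_nonempty_subsingleton]
    exact and_iff_right h₁
  · rw [← Set.not_subsingleton_iff, not_iff_not, Set.exists_eq_singleton_iff_nonempty_subsingleton]
    exact and_iff_right h₂

lemma noNontrivialTight_toSimpleGraph (h : ∀ X, G.IsTightCut X → G.TrivialShore X) :
    G.toSimpleGraph.NoNontrivialTight := fun X hX h' ↦
  (not_trivialShore_iff hX.nonempty hX.compl_nonempty).2 h' (h X (isTight_toSimpleGraph_iff.1 hX))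

lemma exists_isContraction_contract {X : Set G.V} (hX : X.Nonempty) :
    ∃ f, G.toSimpleGraph.IsContraction X (G.contract X).toSimpleGraph f := by
  classical
  let f : G.V → {v : G.V // v ∉ X} ⊕ Unit :=
    fun v ↦ if h : v ∈ X then Sum.inr () else Sum.inl ⟨v, h⟩
  have f₁ {v : G.V} (h : v ∈ X) : f v = Sum.inr () := dif_pos h
  have f₂ {v : G.V} (h : v ∉ X) : f v = Sum.inl ⟨v, h⟩ := dif_neg h
  have hends (e) : (G.contract X).ends e = (G.ends e.1).map f := by
    simp only [contract, f]
  have hf (a b : G.V) : f a = f b ↔ a = b ∨ (a ∈ X ∧ b ∈ X) := by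
    by_cases ha : a ∈ X <;> by_cases hb : b ∈ X
    · simp [f₁ ha, f₁ hb, ha, hb]
    · simp only [f₁ ha, f₂ hb, reduceCtorEq, hb, and_false, or_false, false_iff]
      rintro rfl; exact hb ha
    · simp only [f₂ ha, f₁ hb, reduceCtorEq, ha, false_and, or_false, false_iff]
      rintro rfl; exact ha hb
    · simp [f₂ ha, f₂ hb, ha]
  refine ⟨f, ⟨?_, fun c d ↦ ⟨fun h ↦ ⟨h.1, ?_⟩, ?_⟩⟩, hf⟩
  · rintro (⟨v, hv⟩ | _)
    · exact ⟨v, f₂ hv⟩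
    · obtain ⟨x, hx⟩ := hX
      exact ⟨x, f₁ hx⟩
  · obtain ⟨e, he⟩ := h.2
    obtain ⟨a, b, hab⟩ := Multigraph.Sym2.exists_eq_mk (G.ends e.1)
    have he := Sym2.eq_iff.1 ((congrArg (Sym2.map f) hab).symm.trans ((hends e).symm.trans he))
    rcases he with ⟨rfl, rfl⟩ | ⟨rfl, rfl⟩
    · exact ⟨a, b, rfl, rfl, toSimpleGraph_adj_iff.2 ⟨_, hab⟩⟩
    · exact ⟨b, a, rfl, rfl, (toSimpleGraph_adj_iff.2 ⟨_, hab⟩).symm⟩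
  · rintro ⟨hcd, a, b, rfl, rfl, hab⟩
    obtain ⟨e, he⟩ := toSimpleGraph_adj_iff.1 hab
    refine toSimpleGraph_adj_iff.2 ⟨⟨e, fun h ↦ hcd ((hf a b).2 (.inr ⟨?_, ?_⟩))⟩, ?_⟩
    · exact h a (he ▸ Sym2.mem_mk_left _ _)
    · exact h b (he ▸ Sym2.mem_mk_right _ _)
    · exact (hends ⟨e, _⟩).trans (congrArg (Sym2.map f) he)

theorem BrickCount.toSimpleGraph {n : ℕ} (h : BrickCount G n) :
    G.toSimpleGraph.HasBrickCount n := by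
  induction h with
  | brick G h =>
    exact .brick _ h.1.toSimpleGraph (fun h' ↦ h.2.1 (hasBoolColoring_toSimpleGraph_iff.1 h'))
      (noNontrivialTight_toSimpleGraph h.2.2)
  | brace G h =>
    exact .brace _ h.1.toSimpleGraph (hasBoolColoring_toSimpleGraph_iff.2 h.2.1)
      (noNontrivialTight_toSimpleGraph h.2.2)
  | cut G X ht hnt _ _ ih₁ ih₂ =>
    obtain ⟨f₁, c₁⟩ := exists_isContraction_contract ht.1
    obtain ⟨f₂, c₂⟩ := exists_isContraction_contract ht.2.1
    obtain ⟨h₁, h₂⟩ := (not_trivialShore_iff ht.1 ht.2.1).1 hnt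
    exact .cut _ X (isTight_toSimpleGraph_iff.2 ht) h₁ h₂ c₁ c₂ ih₁ ih₂

namespace BisubWitness

variable {H : Multigraph} {e : G.E} (w : BisubWitness H G e)

/-- The vertices of the subdividing path other than its first vertex. -/
def tail : Set H.V := w.p '' {i | i ≠ 0}

variable {w}

lemma p_mem_tail {i : Fin (w.k + 1)} : w.p i ∈ w.tail ↔ i ≠ 0 :=
  w.p_inj.mem_set_image

lemma zero_ne_last : (0 : Fin (w.k + 1)) ≠ Fin.last w.k := by
  have := w.len
  simp only [ne_eq, Fin.ext_iff, Fin.val_zero, Fin.val_last]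
  omega

lemma eq_last_of_p_eq_φ {i : Fin (w.k + 1)} (hi : i ≠ 0) {g : G.V} (h : w.p i = w.φ g) :
    i = Fin.last w.k := by
  by_contra hl
  exact w.internal_new i hi hl ⟨g, h.symm⟩

lemma φ_mem_tail {g : G.V} : w.φ g ∈ w.tail ↔ g = w.v := by
  constructor
  · rintro ⟨i, hi, h⟩
    rw [eq_last_of_p_eq_φ hi h, w.p_last] at h
    exact (w.φ_inj h).symm
  · rintro rfl
    rw [← w.p_last]
    exact p_mem_tail.2 zero_ne_last.symm

lemma exists_φ_eq {h : H.V} (hh : h ∉ w.tail) : ∃ g, w.φ g = h := by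
  rcases (w.v_cover ▸ Set.mem_univ h : h ∈ Set.range w.φ ∪ Set.range w.p) with hφ | ⟨i, rfl⟩
  · exact hφ
  · obtain rfl : i = 0 := by_contra fun hi ↦ hh (p_mem_tail.2 hi)
    exact ⟨_, w.p_first.symm⟩

lemma ncard_tail : w.tail.ncard = w.k := by
  rw [tail, Set.ncard_image_of_injective _ w.p_inj]
  have : {i : Fin (w.k + 1) | i ≠ 0} = Set.range Fin.succ := by
    ext i
    simp
  rw [this, ← Set.image_univ, Set.ncard_image_of_injective _ (Fin.succ_injective _),
    Set.ncard_univ, Nat.card_eq_fintype_card, Fintype.card_fin]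

lemma exists_of_adj {a b : H.V} (h : H.toSimpleGraph.Adj a b) :
    (∃ x y, G.toSimpleGraph.Adj x y ∧ a = w.φ x ∧ b = w.φ y) ∨
      ∃ i : Fin w.k, s(a, b) = s(w.p i.castSucc, w.p i.succ) := by
  obtain ⟨f, hf⟩ := toSimpleGraph_adj_iff.1 h
  rcases (w.e_cover ▸ Set.mem_univ f : f ∈ Set.range w.ψ ∪ Set.range w.q) with ⟨g, rfl⟩ | ⟨i, rfl⟩
  · left
    obtain ⟨x, y, hxy⟩ := Multigraph.Sym2.exists_eq_mk (G.ends g.1)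
    have hadj := toSimpleGraph_adj_iff.2 ⟨_, hxy⟩
    rw [w.ψ_ends, hxy, Sym2.map_mk, Sym2.eq_iff] at hf
    rcases hf with ⟨h₁, h₂⟩ | ⟨h₁, h₂⟩
    · exact ⟨x, y, hadj, h₁.symm, h₂.symm⟩
    · exact ⟨y, x, hadj.symm, h₂.symm, h₁.symm⟩
  · exact .inr ⟨i, by rw [← hf, w.q_ends]⟩

lemma adj_p (i : Fin w.k) : H.toSimpleGraph.Adj (w.p i.castSucc) (w.p i.succ) :=
  toSimpleGraph_adj_iff.2 ⟨_, w.q_ends i⟩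

lemma adj_φ_or {x y : G.V} (h : G.toSimpleGraph.Adj x y) :
    H.toSimpleGraph.Adj (w.φ x) (w.φ y) ∨ s(x, y) = s(w.u, w.v) := by
  obtain ⟨f, hf⟩ := toSimpleGraph_adj_iff.1 h
  by_cases hfe : f = e
  · exact .inr (by rw [← hf, hfe, w.ends_e])
  · exact .inl (toSimpleGraph_adj_iff.2 ⟨w.ψ ⟨f, hfe⟩, by rw [w.ψ_ends, hf, Sym2.map_mk]⟩)

variable (w) in
lemma adj_ends : G.toSimpleGraph.Adj w.u w.v :=
  toSimpleGraph_adj_iff.2 ⟨_, w.ends_e⟩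

variable (w) in
lemma exists_adj_first : ∃ b ∈ w.tail, H.toSimpleGraph.Adj (w.φ w.u) b := by
  have hk : 0 < w.k := by have := w.len; omega
  refine ⟨w.p (Fin.succ ⟨0, hk⟩), p_mem_tail.2 (Fin.succ_ne_zero _), ?_⟩
  rw [← w.p_first]
  exact w.adj_p ⟨0, hk⟩

variable (w) in
lemma exists_isContraction :
    ∃ f, H.toSimpleGraph.IsContraction w.tail G.toSimpleGraph f := by
  classical
  let f : H.V → G.V := fun h ↦ if hh : h ∈ w.tail then w.v else (exists_φ_eq hh).choose
  have f_mem {h : H.V} (hh : h ∈ w.tail) : f h = w.v := dif_pos hh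
  have f_φ (g : G.V) : f (w.φ g) = g := by
    by_cases hg : w.φ g ∈ w.tail
    · rw [f_mem hg, φ_mem_tail.1 hg]
    · refine w.φ_inj ?_
      simp only [f, dif_neg hg]
      exact (exists_φ_eq hg).choose_spec
  have f_ne {h : H.V} (hh : h ∉ w.tail) : f h ≠ w.v := by
    obtain ⟨g, rfl⟩ := exists_φ_eq hh
    rw [f_φ]
    exact fun hg ↦ hh (φ_mem_tail.2 hg)
  refine ⟨f, ⟨fun g ↦ ⟨_, f_φ g⟩, fun c d ↦ ⟨fun hcd ↦ ⟨hcd.ne, ?_⟩, ?_⟩⟩, fun a b ↦ ?_⟩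
  · rcases w.adj_φ_or hcd with h | h
    · exact ⟨_, _, f_φ c, f_φ d, h⟩
    · obtain ⟨b, hb, hadj⟩ := w.exists_adj_first
      rcases Sym2.eq_iff.1 h with ⟨rfl, rfl⟩ | ⟨rfl, rfl⟩
      · exact ⟨_, _, f_φ _, f_mem hb, hadj⟩
      · exact ⟨_, _, f_mem hb, f_φ _, hadj.symm⟩
  · rintro ⟨hcd, a, b, rfl, rfl, hab⟩
    rcases w.exists_of_adj hab with ⟨x, y, hxy, rfl, rfl⟩ | ⟨i, hi⟩
    · rwa [f_φ, f_φ]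
    · have hf₁ : f (w.p i.succ) = w.v := f_mem (p_mem_tail.2 (Fin.succ_ne_zero _))
      have hf₀ : f (w.p i.castSucc) = w.v ∨ f (w.p i.castSucc) = w.u := by
        by_cases h0 : i.castSucc = 0
        · rw [h0, w.p_first, f_φ]
          exact .inr rfl
        · exact .inl (f_mem (p_mem_tail.2 h0))
      rcases Sym2.eq_iff.1 hi with ⟨rfl, rfl⟩ | ⟨rfl, rfl⟩
      · rw [hf₁] at hcd ⊢
        rw [hf₀.resolve_left hcd]
        exact w.adj_ends
      · rw [hf₁] at hcd ⊢
        rw [hf₀.resolve_left hcd.symm]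
        exact w.adj_ends.symm
  · by_cases ha : a ∈ w.tail <;> by_cases hb : b ∈ w.tail
    · simp [f_mem ha, f_mem hb, ha, hb]
    · simp only [f_mem ha, (f_ne hb).symm, hb, and_false, or_false, false_iff]
      exact fun h ↦ hb (h ▸ ha)
    · simp only [f_mem hb, f_ne ha, ha, false_and, or_false, false_iff]
      exact fun h ↦ ha (h ▸ hb)
    · obtain ⟨x, rfl⟩ := exists_φ_eq ha
      obtain ⟨y, rfl⟩ := exists_φ_eq hb
      simp [f_φ, ha, w.φ_inj.eq_iff]

lemma crossing_subset {σ : H.V → H.V} (hσ : H.toSimpleGraph.IsMatchingInvolution σ) :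
    SimpleGraph.crossing σ w.tail ⊆ {w.φ w.v, σ (w.φ w.u)} := by
  rintro a ⟨ha, ha'⟩
  rcases w.exists_of_adj (hσ.adj a) with ⟨x, y, hxy, rfl, -⟩ | ⟨i, hi⟩
  · exact .inl (by rw [φ_mem_tail.1 ha])
  · right
    have hs : w.p i.succ ∈ w.tail := p_mem_tail.2 (Fin.succ_ne_zero _)
    rcases Sym2.eq_iff.1 hi with ⟨h₁, h₂⟩ | ⟨h₁, h₂⟩
    · exact absurd (h₂ ▸ hs) ha'
    · have h0 : i.castSucc = 0 := by_contra fun h0 ↦ ha' (h₂ ▸ p_mem_tail.2 h0)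
      rw [Set.mem_singleton_iff, ← w.p_first, ← h0, ← h₂, hσ.invol]

variable (w) in
lemma isTight_tail : H.toSimpleGraph.IsTight w.tail where
  nonempty := ⟨_, φ_mem_tail.2 rfl⟩
  compl_nonempty := ⟨w.p 0, fun h ↦ p_mem_tail.1 h rfl⟩
  existsUnique σ hσ := by
    have h₁ := hσ.ncard_crossing_mod_two w.tail
    rw [ncard_tail, Nat.odd_iff.1 w.odd] at h₁
    have h₂ := (Set.ncard_le_ncard (crossing_subset (w := w) hσ) (Set.toFinite _)).trans
      (Set.ncard_insert_le _ _)
    rw [Set.ncard_singleton] at h₂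
    exact SimpleGraph.ncard_crossing_eq_one_iff.1 (by omega)

variable (w) in
lemma exists_coloring : ∃ c : H.V → Bool, (∀ a ∉ w.tail, c a = false) ∧
    ∀ a b, H.toSimpleGraph.Adj a b → a ∈ w.tail ∨ b ∈ w.tail → c a ≠ c b := by
  classical
  let c : H.V → Bool := fun h ↦ decide (∃ i, Odd i.val ∧ w.p i = h)
  have c_p (i) : c (w.p i) = decide (Odd i.val) := by
    simp [c, w.p_inj.eq_iff]
  have c_not {a : H.V} (ha : a ∉ w.tail) : c a = false := by
    refine decide_eq_false ?_
    rintro ⟨i, hi, rfl⟩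
    refine ha (p_mem_tail.2 ?_)
    rintro rfl
    simp at hi
  have c_v : c (w.φ w.v) = true := by
    rw [← w.p_last, c_p, Fin.val_last, decide_eq_true w.odd]
  refine ⟨c, fun a ↦ c_not, fun a b hab h ↦ ?_⟩
  rcases w.exists_of_adj hab with ⟨x, y, hxy, rfl, rfl⟩ | ⟨i, hi⟩
  · have hne : x ≠ y := hxy.ne
    rcases h with h | h
    · obtain rfl := φ_mem_tail.1 h
      rw [c_v, c_not fun hy ↦ hne (φ_mem_tail.1 hy).symm]
      exact Bool.noConfusion
    · obtain rfl := φ_mem_tail.1 h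
      rw [c_v, c_not fun hx ↦ hne (φ_mem_tail.1 hx)]
      exact Bool.noConfusion
  · have key : c (w.p i.castSucc) ≠ c (w.p i.succ) := by
      rw [c_p, c_p, Fin.val_succ, Fin.val_castSucc]
      by_cases hi : Odd i.val <;> simp [Nat.odd_add_one, hi]
    rcases Sym2.eq_iff.1 hi with ⟨rfl, rfl⟩ | ⟨rfl, rfl⟩
    · exact key
    · exact key.symm

variable (w) in
lemma hasBoolColoring_of_isContraction {W : Type} {K : SimpleGraph W} {f : H.V → W}
    (hf : H.toSimpleGraph.IsContraction w.tailᶜ K f) : K.HasBoolColoring := by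
  obtain ⟨c, hc₁, hc₂⟩ := w.exists_coloring
  have hs (x : W) : f (Function.surjInv hf.surjective x) = x := Function.surjInv_eq _ x
  have key (a : H.V) : c (Function.surjInv hf.surjective (f a)) = c a := by
    rcases (hf.eq_iff _ _).1 (hs (f a)) with h | ⟨h₁, h₂⟩
    · rw [h]
    · rw [hc₁ _ h₁, hc₁ _ h₂]
  refine ⟨c ∘ Function.surjInv hf.surjective, fun x y hxy ↦ ?_⟩
  obtain ⟨hne, a, b, rfl, rfl, hab⟩ := (hf.adj_iff _ _).1 hxy
  rw [Function.comp_apply, Function.comp_apply, key, key]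
  refine hc₂ _ _ hab (or_iff_not_imp_left.2 fun ha ↦ by_contra fun hb ↦ hne ?_)
  exact (hf.eq_iff _ _).2 (.inr ⟨ha, hb⟩)

variable (w) in
lemma tail_nontrivial : w.tail.Nontrivial := by
  have := w.len
  rw [← Set.one_lt_ncard_iff_nontrivial, ncard_tail]
  omega

lemma brickCount_eq (w : BisubWitness H G e) (hH : H.toSimpleGraph.IsMatchingCovered) {n m : ℕ}
    (hn : G.toSimpleGraph.HasBrickCount n) (hm : H.toSimpleGraph.HasBrickCount m) : n = m := by
  obtain ⟨f₁, hf₁⟩ := w.exists_isContraction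
  have hX := w.isTight_tail
  by_cases hc : w.tailᶜ.Nontrivial
  · obtain ⟨W, K, f₂, hf₂⟩ := H.toSimpleGraph.exists_isContraction w.tailᶜ
    have hK := hf₂.isMatchingCovered hH hX.compl
    have : Finite W := Finite.of_surjective _ hf₂.surjective
    obtain ⟨l, hl⟩ := hK.exists_hasBrickCount
    obtain rfl := hl.eq_zero_of_hasBoolColoring hK (w.hasBoolColoring_of_isContraction hf₂)
    exact (SimpleGraph.HasBrickCount.cut _ _ hX w.tail_nontrivial hc hf₁ hf₂ hn hl).unique hH hm
  · have hb : H.toSimpleGraph.HasBoolColoring := by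
      obtain ⟨c, -, hc₂⟩ := w.exists_coloring
      refine ⟨c, fun a b hab ↦ hc₂ a b hab ?_⟩
      by_contra! h
      exact hc ⟨a, h.1, b, h.2, hab.ne⟩
    rw [hm.eq_zero_of_hasBoolColoring hH hb]
    exact hn.eq_zero_of_hasBoolColoring (hf₁.isMatchingCovered hH hX)
      (hf₁.hasBoolColoring hH hX hb)

end BisubWitness

end Multigraph

/-- If `H` is a bisubdivision of `G` at an edge `e` and `H` is matching covered,
then `G` and `H` have the same number of bricks: `b(G) = b(H)`. -/
theorem bisubdivision_brickCount_eq
    (G H : Multigraph) (e : G.E) (hb : Multigraph.IsBisubdivisionAt H G e)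
    (hH : H.MatchingCovered) :
    ∀ n m : ℕ, Multigraph.BrickCount G n → Multigraph.BrickCount H m → n = m := by
  intro n m hn hm
  obtain ⟨w⟩ := hb
  exact w.brickCount_eq hH.toSimpleGraph hn.toSimpleGraph hm.toSimpleGraph
end
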